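/- Let (W,S) be a finite Coxeter system and c a Coxeter element. The set of c-singletons of W, partially ordered by the restriction of the right weak order, is a distributive lattice; moreover it is a sublattice of the weak order on W (the meet and join of two c-singletons in the weak order exist, are c-singletons, and give the lattice operations). -/

import Mathlib

noncomputable section

namespace CambrianPaper

open CoxeterSystem

variable {B : Type*} {W : Type*} [Group W] {M : CoxeterMatrix B}

/-- One greedy pass of the letters of `c` over `u`: returns the taken letters (in order) and
the new remainder.  A letter `q` is taken if it is a left descent of the current remainder. -/
def pass (cs : CoxeterSystem M W) (c : List B) (u : W) : List B × W :=
  c.foldl (fun p q =>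
    if cs.length (cs.simple q * p.2) < cs.length p.2 then (p.1 ++ [q], cs.simple q * p.2)
    else p) ([], u)

/-- The remainder of `w` after `n` greedy passes of `c`. -/
def remainder (cs : CoxeterSystem M W) (c : List B) (w : W) : ℕ → W
  | 0 => w
  | n + 1 => (pass cs c (remainder cs c w n)).2

/-- The `n`-th factor (`n = 0, 1, 2, …`) of the `c`-factorization of `w`:
the letters of `c` taken in the `n`-th greedy pass.  (All but finitely many factors are
empty; the nonempty ones are the `c_{(K_i)}` of the `c`-factorization of `w`.) -/
def factor (cs : CoxeterSystem M W) (c : List B) (w : W) (n : ℕ) : List B :=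
  (pass cs c (remainder cs c w n)).1

/-- The `c`-sorting word of `w` : the concatenation of the factors of the
`c`-factorization of `w` (the lexicographically first reduced subword of `c^∞` for `w`);
`cs.length w` passes always suffice. -/
def sortingWord (cs : CoxeterSystem M W) (c : List B) (w : W) : List B :=
  ((List.range (cs.length w)).map (factor cs c w)).flatten

/-- `w` is `c`-sortable : the factors of its `c`-factorization are nested. -/
def IsSortable (cs : CoxeterSystem M W) (c : List B) (w : W) : Prop :=
  ∀ n : ℕ, ∀ q ∈ factor cs c w (n + 1), q ∈ factor cs c w n

/-- `w` is a `c`-singleton : `w` is `c`-sortable and `w w₀` is `c⁻¹`-sortable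
(the reduced word `c.reverse` represents the inverse of the Coxeter element). -/
def IsCSingleton (cs : CoxeterSystem M W) (c : List B) (w₀ w : W) : Prop :=
  IsSortable cs c w ∧ IsSortable cs c.reverse (w * w₀)

/-- The right weak order on `W`. -/
def weakLE (cs : CoxeterSystem M W) (u v : W) : Prop :=
  cs.length v = cs.length u + cs.length (u⁻¹ * v)

/-- A single commutation move on words: interchange two adjacent commuting letters. -/
def CommMove (M : CoxeterMatrix B) (l l' : List B) : Prop :=
  ∃ l₁ l₂ : List B, ∃ a b : B, M a b = 2 ∧ l = l₁ ++ a :: b :: l₂ ∧ l' = l₁ ++ b :: a :: l₂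

/-- Equivalence of words up to commutations. -/
def CommEquiv (M : CoxeterMatrix B) : List B → List B → Prop :=
  Relation.ReflTransGen (CommMove M)

/-- `u ∈ W` is a prefix of the word `v` up to commutations. -/
def IsPrefixUpToComm (cs : CoxeterSystem M W) (v : List B) (u : W) : Prop :=
  ∃ v' u' : List B, CommEquiv M v v' ∧ u' <+: v' ∧ cs.wordProd u' = u

/-! ### The geometric representation -/

/-- The entry `-cos (π / m)` of the Gram matrix of the geometric representation. -/
def gram (M : CoxeterMatrix B) (s t : B) : ℝ := -Real.cos (Real.pi / M s t)

theorem gram_comm (M : CoxeterMatrix B) (s t : B) : gram M s t = gram M t s := by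
  rw [gram, gram, M.symmetric]

theorem gram_self (M : CoxeterMatrix B) (s : B) : gram M s s = 1 := by
  simp [gram]

theorem gram_nonpos (M : CoxeterMatrix B) {s t : B} (h : s ≠ t) : gram M s t ≤ 0 := by
  have h1 := M.off_diagonal s t h
  rw [gram, neg_nonpos]
  rcases Nat.eq_zero_or_pos (M s t) with h0 | h0
  · simp [h0]
  · have h2 : (2 : ℝ) ≤ M s t := by
      have : 2 ≤ M s t := by
        have : M s t ≠ 1 := h1
        omega
      exact_mod_cast this
    have hpi := Real.pi_pos
    apply Real.cos_nonneg_of_neg_pi_div_two_le_of_le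
    · have : 0 ≤ Real.pi / M s t := by positivity
      linarith
    · gcongr

theorem eq_two_of_gram_eq_zero (M : CoxeterMatrix B) {s t : B} (h : s ≠ t)
    (h0 : gram M s t = 0) : M s t = 2 := by
  by_contra h2
  have h1 : M s t ≠ 1 := M.off_diagonal s t h
  rw [gram, neg_eq_zero] at h0
  rcases Nat.eq_zero_or_pos (M s t) with hm | hm
  · simp [hm] at h0
  · have h3 : (3 : ℝ) ≤ M s t := by
      have : 3 ≤ M s t := by omega
      exact_mod_cast this
    have hpi := Real.pi_pos
    have hlt : Real.pi / M s t < Real.pi / 2 := by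
      apply div_lt_div_of_pos_left hpi (by norm_num) (by linarith)
    have := Real.cos_pos_of_mem_Ioo (x := Real.pi / M s t)
      ⟨by have : 0 ≤ Real.pi / M s t := by positivity
          linarith, hlt⟩
    linarith

theorem gram_eq_zero (M : CoxeterMatrix B) {s t : B} (h : M s t = 2) : gram M s t = 0 := by
  simp [gram, h]

/-- The bilinear form with prescribed values on the standard basis. -/
def bilin (k : B → B → ℝ) : (B →₀ ℝ) →ₗ[ℝ] (B →₀ ℝ) →ₗ[ℝ] ℝ :=
  Finsupp.linearCombination ℝ fun s => Finsupp.linearCombination ℝ (k s)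

/-- The simple root of `s`. -/
def simpleRoot (s : B) : B →₀ ℝ := Finsupp.single s 1

@[simp]
theorem bilin_simpleRoot (k : B → B → ℝ) (s t : B) :
    bilin k (simpleRoot s) (simpleRoot t) = k s t := by
  simp [bilin, simpleRoot]

theorem simpleRoot_apply_self (s : B) : simpleRoot s s = 1 := by simp [simpleRoot]

theorem simpleRoot_apply_of_ne {s t : B} (h : s ≠ t) : simpleRoot s t = 0 := by
  simp [simpleRoot, h]

theorem simpleRoot_nonneg (s : B) : 0 ≤ simpleRoot s := by
  simp [simpleRoot]

theorem bilin_hom_ext {f g : (B →₀ ℝ) →ₗ[ℝ] (B →₀ ℝ) →ₗ[ℝ] ℝ}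
    (h : ∀ s t, f (simpleRoot s) (simpleRoot t) = g (simpleRoot s) (simpleRoot t)) : f = g := by
  apply Finsupp.lhom_ext'
  intro s
  apply LinearMap.ext_ring
  apply Finsupp.lhom_ext'
  intro t
  apply LinearMap.ext_ring
  exact h s t

theorem linear_hom_ext {E : Type*} [AddCommGroup E] [Module ℝ E] {f g : (B →₀ ℝ) →ₗ[ℝ] E}
    (h : ∀ s, f (simpleRoot s) = g (simpleRoot s)) : f = g := by
  apply Finsupp.lhom_ext'
  intro s
  apply LinearMap.ext_ring
  exact h s

theorem bilin_comm {k : B → B → ℝ} (hk : ∀ s t, k s t = k t s) (x y : B →₀ ℝ) :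
    bilin k x y = bilin k y x := by
  have : bilin k = (bilin k).flip := bilin_hom_ext fun s t => by simp [hk s t]
  conv_lhs => rw [this]
  rfl

theorem bilin_simpleRoot_left (k : B → B → ℝ) (s : B) (x : B →₀ ℝ) :
    bilin k (simpleRoot s) x = x.sum fun t a => a * k s t := by
  simp [bilin, simpleRoot, Finsupp.linearCombination_apply]

/-- The invariant symmetric form of the geometric representation. -/
abbrev form (M : CoxeterMatrix B) : (B →₀ ℝ) →ₗ[ℝ] (B →₀ ℝ) →ₗ[ℝ] ℝ := bilin (gram M)

theorem form_comm (M : CoxeterMatrix B) (x y : B →₀ ℝ) : form M x y = form M y x :=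
  bilin_comm (gram_comm M) x y

/-- The reflection in the simple root of `s`. -/
def simpleRefl (M : CoxeterMatrix B) (s : B) : Module.End ℝ (B →₀ ℝ) :=
  LinearMap.id - ((2 : ℝ) • form M (simpleRoot s)).smulRight (simpleRoot s)

theorem simpleRefl_apply (M : CoxeterMatrix B) (s : B) (x : B →₀ ℝ) :
    simpleRefl M s x = x - (2 * form M (simpleRoot s) x) • simpleRoot s := by
  simp [simpleRefl]

theorem simpleRefl_mul_self (M : CoxeterMatrix B) (s : B) :
    simpleRefl M s * simpleRefl M s = 1 := by
  refine linear_hom_ext fun x => ?_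
  simp only [Module.End.mul_apply, simpleRefl_apply, map_sub, map_smul,
    bilin_simpleRoot, gram_self, Module.End.one_apply]
  module

theorem form_simpleRefl (M : CoxeterMatrix B) (s : B) (x y : B →₀ ℝ) :
    form M (simpleRefl M s x) (simpleRefl M s y) = form M x y := by
  simp only [simpleRefl_apply, map_sub, map_smul, LinearMap.sub_apply, LinearMap.smul_apply,
    bilin_simpleRoot, gram_self, smul_eq_mul, form_comm M x (simpleRoot s)]
  ring

theorem simpleRefl_sin_combination (M : CoxeterMatrix B) (s t : B) (φ : ℝ) :
    simpleRefl M t (Real.sin (φ + Real.pi / M s t) • simpleRoot s + Real.sin φ • simpleRoot t) =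
      Real.sin (φ + Real.pi / M s t) • simpleRoot s +
        Real.sin (φ + 2 * (Real.pi / M s t)) • simpleRoot t := by
  have key : Real.sin (φ + 2 * (Real.pi / M s t)) =
      2 * Real.cos (Real.pi / M s t) * Real.sin (φ + Real.pi / M s t) - Real.sin φ := by
    have h1 : φ + 2 * (Real.pi / M s t) = (φ + Real.pi / M s t) + Real.pi / M s t := by ring
    have h2 : φ = (φ + Real.pi / M s t) - Real.pi / M s t := by ring
    rw [h1, Real.sin_add]
    nth_rewrite 4 [h2]
    rw [Real.sin_sub]
    ring
  rw [simpleRefl_apply, key]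
  simp only [map_add, map_smul, bilin_simpleRoot, gram_self, smul_eq_mul, gram_comm M t s]
  simp only [gram]
  module

theorem simpleRefl_mul_pow_sin_combination (M : CoxeterMatrix B) (s t : B) (φ : ℝ) (n : ℕ) :
    ((simpleRefl M s * simpleRefl M t) ^ n)
        (Real.sin (φ + Real.pi / M s t) • simpleRoot s + Real.sin φ • simpleRoot t) =
      Real.sin (φ + n * (2 * (Real.pi / M s t)) + Real.pi / M s t) • simpleRoot s +
        Real.sin (φ + n * (2 * (Real.pi / M s t))) • simpleRoot t := by
  induction n with
  | zero => simp
  | succ n ih =>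
    rw [pow_succ', Module.End.mul_apply, ih, Module.End.mul_apply, simpleRefl_sin_combination,
      add_comm (Real.sin _ • simpleRoot s)]
    have h := simpleRefl_sin_combination M t s (φ + n * (2 * (Real.pi / M s t)) + Real.pi / M s t)
    rw [M.symmetric t s] at h
    have h1 : φ + n * (2 * (Real.pi / M s t)) + Real.pi / M s t + Real.pi / M s t =
      φ + n * (2 * (Real.pi / M s t)) + 2 * (Real.pi / M s t) := by ring
    rw [h1] at h
    rw [h, add_comm]
    push_cast
    congr 3 <;> ring

theorem simpleRefl_mul_pow (M : CoxeterMatrix B) (s t : B) :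
    (simpleRefl M s * simpleRefl M t) ^ M s t = 1 := by
  by_cases hst : s = t
  · subst hst
    rw [simpleRefl_mul_self, one_pow]
  by_cases h0 : M s t = 0
  · rw [h0, pow_zero]
  have h1 : M s t ≠ 1 := M.off_diagonal s t hst
  set θ := Real.pi / M s t with hθ
  have hmpos : (0 : ℝ) < M s t := by exact_mod_cast Nat.pos_of_ne_zero h0
  have hmθ : (M s t : ℝ) * (2 * θ) = 2 * Real.pi := by rw [hθ]; field_simp
  have hθlt : θ < Real.pi := by
    rw [hθ, div_lt_iff₀ hmpos]
    have : (1 : ℝ) < M s t := by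
      have : 1 < M s t := by omega
      exact_mod_cast this
    nlinarith [Real.pi_pos]
  have hsin : 0 < Real.sin θ := Real.sin_pos_of_pos_of_lt_pi (by positivity) hθlt
  set R := (simpleRefl M s * simpleRefl M t) ^ M s t with hR
  have hfix : ∀ φ : ℝ, R (Real.sin (φ + θ) • simpleRoot s + Real.sin φ • simpleRoot t) =
      Real.sin (φ + θ) • simpleRoot s + Real.sin φ • simpleRoot t := by
    intro φ
    rw [hR, simpleRefl_mul_pow_sin_combination, ← hθ, hmθ,
      show φ + 2 * Real.pi + θ = φ + θ + 2 * Real.pi by ring, Real.sin_add_two_pi,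
      Real.sin_add_two_pi]
  have hs : R (simpleRoot s) = simpleRoot s := by
    have h := hfix 0
    simp only [zero_add, Real.sin_zero, zero_smul, add_zero, map_smul] at h
    exact smul_right_injective (B →₀ ℝ) hsin.ne' h
  have ht : R (simpleRoot t) = simpleRoot t := by
    have h := hfix (-θ)
    simp only [neg_add_cancel, Real.sin_zero, zero_smul, zero_add, map_smul, Real.sin_neg] at h
    exact smul_right_injective (B →₀ ℝ) (neg_ne_zero.2 hsin.ne') h
  have horth : ∀ z, form M (simpleRoot s) z = 0 → form M (simpleRoot t) z = 0 → R z = z := by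
    intro z hz1 hz2
    have : ∀ n : ℕ, ((simpleRefl M s * simpleRefl M t) ^ n) z = z := by
      intro n
      induction n with
      | zero => rfl
      | succ n ih =>
        rw [pow_succ', Module.End.mul_apply, ih, Module.End.mul_apply, simpleRefl_apply M t,
          hz2, mul_zero, zero_smul, sub_zero, simpleRefl_apply, hz1, mul_zero, zero_smul, sub_zero]
    exact this _
  refine linear_hom_ext fun x => ?_
  generalize simpleRoot x = z
  rw [Module.End.one_apply]
  set g := gram M s t with hg
  have hdet : 1 - g ^ 2 ≠ 0 := by
    have : 1 - g ^ 2 = Real.sin θ ^ 2 := by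
      rw [hg, gram, ← hθ]
      have := Real.sin_sq_add_cos_sq θ
      linarith
    rw [this]
    positivity
  set a := form M (simpleRoot s) z
  set b := form M (simpleRoot t) z
  set p := (a - g * b) / (1 - g ^ 2) with hp
  set q := (b - g * a) / (1 - g ^ 2) with hq
  have hz : z = (z - p • simpleRoot s - q • simpleRoot t) +
    (p • simpleRoot s + q • simpleRoot t) := by abel
  rw [hz, map_add, horth, map_add, map_smul, map_smul, hs, ht]
  · simp only [map_sub, map_smul, bilin_simpleRoot, gram_self, smul_eq_mul, mul_one]
    change a - p - q * g = 0
    rw [hp, hq]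
    field_simp
    ring
  · simp only [map_sub, map_smul, bilin_simpleRoot, gram_self, smul_eq_mul, mul_one,
      gram_comm M t s]
    change b - p * g - q = 0
    rw [hp, hq]
    field_simp
    ring

/-- The geometric representation of a Coxeter group. -/
def geomRep (cs : CoxeterSystem M W) : W →* Module.End ℝ (B →₀ ℝ) :=
  cs.lift ⟨simpleRefl M, simpleRefl_mul_pow M⟩

theorem geomRep_simple (cs : CoxeterSystem M W) (s : B) :
    geomRep cs (cs.simple s) = simpleRefl M s :=
  cs.lift_apply_simple (simpleRefl_mul_pow M) s

theorem geomRep_simple_apply (cs : CoxeterSystem M W) (s : B) (x : B →₀ ℝ) :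
    geomRep cs (cs.simple s) x = x - (2 * form M (simpleRoot s) x) • simpleRoot s := by
  rw [geomRep_simple, simpleRefl_apply]

theorem geomRep_mul_apply (cs : CoxeterSystem M W) (u v : W) (x : B →₀ ℝ) :
    geomRep cs (u * v) x = geomRep cs u (geomRep cs v x) := by
  rw [map_mul, Module.End.mul_apply]

theorem geomRep_simple_simple_apply (cs : CoxeterSystem M W) (s : B) (x : B →₀ ℝ) :
    geomRep cs (cs.simple s) (geomRep cs (cs.simple s) x) = x := by
  rw [← geomRep_mul_apply, cs.simple_mul_simple_self, map_one, Module.End.one_apply]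

theorem geomRep_simple_simpleRoot (cs : CoxeterSystem M W) (s : B) :
    geomRep cs (cs.simple s) (simpleRoot s) = -simpleRoot s := by
  rw [geomRep_simple_apply, bilin_simpleRoot, gram_self]
  module

theorem form_geomRep (cs : CoxeterSystem M W) (w : W) (x y : B →₀ ℝ) :
    form M (geomRep cs w x) (geomRep cs w y) = form M x y := by
  induction w using cs.simple_induction_left with
  | one => simp
  | mul_simple_left w s ih =>
    rw [geomRep_mul_apply, geomRep_mul_apply, geomRep_simple, form_simpleRefl, ih]

theorem geomRep_simple_apply_of_ne (cs : CoxeterSystem M W) {s t : B} (h : t ≠ s) (x : B →₀ ℝ) :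
    geomRep cs (cs.simple s) x t = x t := by
  rw [geomRep_simple_apply, Finsupp.sub_apply, Finsupp.smul_apply,
    simpleRoot_apply_of_ne h.symm, smul_zero, sub_zero]

/-- In a finite Coxeter group all the entries of the Coxeter matrix are finite. -/
theorem coxeterMatrix_ne_zero [Finite W] (cs : CoxeterSystem M W) (s t : B) : M s t ≠ 0 := by
  intro h0
  have hst : s ≠ t := by
    rintro rfl
    simp at h0
  have hg : gram M s t = -1 := by simp [gram, h0]
  have hpow : ∀ n : ℕ, geomRep cs ((cs.simple s * cs.simple t) ^ n) (simpleRoot s) =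
      (2 * n + 1 : ℝ) • simpleRoot s + (2 * n : ℝ) • simpleRoot t := by
    intro n
    induction n with
    | zero => simp
    | succ n ih =>
      rw [pow_succ', geomRep_mul_apply, ih, geomRep_mul_apply, geomRep_simple_apply,
        geomRep_simple_apply]
      simp only [map_add, map_sub, map_smul, bilin_simpleRoot, gram_self, smul_eq_mul,
        gram_comm M t s, hg]
      push_cast
      module
  obtain ⟨n, hn, h⟩ := (isOfFinOrder_of_finite (cs.simple s * cs.simple t)).exists_pow_eq_one
  have h1 := congrArg (fun v => v t) (hpow n)
  simp only [h, map_one, Module.End.one_apply, simpleRoot_apply_of_ne hst, Finsupp.add_apply,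
    Finsupp.smul_apply, simpleRoot_apply_self, smul_eq_mul, mul_zero, mul_one, zero_add] at h1
  have : (0 : ℝ) < n := by exact_mod_cast hn
  linarith

/-! ### Roots and inversion sets -/

theorem sin_smul_geomRep_alternatingWord (cs : CoxeterSystem M W) (s t : B) (n : ℕ) :
    Real.sin (Real.pi / M s t) •
        geomRep cs (cs.wordProd (alternatingWord s t n)) (simpleRoot s) =
      if Even n then
        Real.sin (n * (Real.pi / M s t) + Real.pi / M s t) • simpleRoot s +
          Real.sin (n * (Real.pi / M s t)) • simpleRoot t
      else
        Real.sin (n * (Real.pi / M s t)) • simpleRoot s +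
          Real.sin (n * (Real.pi / M s t) + Real.pi / M s t) • simpleRoot t := by
  induction n with
  | zero => simp [alternatingWord]
  | succ n ih =>
    rw [alternatingWord_succ', cs.wordProd_cons, geomRep_mul_apply, ← map_smul, ih]
    by_cases hn : Even n
    · have hn' : ¬Even (n + 1) := by simpa [Nat.even_add_one] using hn
      simp only [if_pos hn, if_neg hn', geomRep_simple]
      rw [simpleRefl_sin_combination]
      push_cast
      congr 3 <;> ring
    · have hn' : Even (n + 1) := by simpa [Nat.even_add_one] using hn
      simp only [if_neg hn, if_pos hn', geomRep_simple]
      have h := simpleRefl_sin_combination M t s (n * (Real.pi / M s t))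
      rw [M.symmetric t s] at h
      rw [add_comm, h, add_comm]
      push_cast
      congr 3 <;> ring

theorem exists_maximal_alternating_suffix (cs : CoxeterSystem M W) (w : W) (s t : B)
    (h : cs.IsRightDescent w t) :
    ∃ v n, 0 < n ∧ w = v * cs.wordProd (alternatingWord s t n) ∧
      cs.length w = cs.length v + n ∧ ¬cs.IsRightDescent v s ∧ ¬cs.IsRightDescent v t := by
  classical
  let P : ℕ → Prop := fun n => ∃ v, w = v * cs.wordProd (alternatingWord s t n) ∧
    cs.length w = cs.length v + n
  have h1 : P 1 := by
    refine ⟨w * cs.simple t, ?_, ?_⟩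
    · simp [alternatingWord]
    · rw [cs.isRightDescent_iff] at h
      omega
  have hlen : 1 ≤ cs.length w := by
    obtain ⟨v, -, hv⟩ := h1
    omega
  set n := Nat.findGreatest P (cs.length w) with hn
  have hn1 : 1 ≤ n := Nat.le_findGreatest hlen h1
  obtain ⟨v, hv, hl⟩ : P n := Nat.findGreatest_spec hlen h1
  have hnext : ¬cs.IsRightDescent v (if Even n then t else s) := by
    intro hd
    rw [cs.isRightDescent_iff] at hd
    have : P (n + 1) := by
      refine ⟨v * cs.simple (if Even n then t else s), ?_, by omega⟩
      rw [alternatingWord_succ', cs.wordProd_cons, mul_assoc, ← mul_assoc (cs.simple _),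
        cs.simple_mul_simple_self, one_mul, hv]
    have := Nat.le_findGreatest (P := P) (n := cs.length w) (by omega) this
    omega
  have hprev : ¬cs.IsRightDescent v (if Even n then s else t) := by
    intro hd
    rw [cs.isRightDescent_iff] at hd
    obtain ⟨m, hm⟩ : ∃ m, n = m + 1 := ⟨n - 1, by omega⟩
    have hy : (if Even n then s else t) = if Even m then t else s := by
      by_cases hme : Even m <;> simp [hm, Nat.even_add_one, hme]
    rw [hy] at hd
    have hw : w = v * cs.simple (if Even m then t else s) *
        cs.wordProd (alternatingWord s t m) := by
      rw [hv, hm, alternatingWord_succ', cs.wordProd_cons, mul_assoc]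
    have h2 := cs.length_mul_le (v * cs.simple (if Even m then t else s))
      (cs.wordProd (alternatingWord s t m))
    have h3 := cs.length_wordProd_le (alternatingWord s t m)
    rw [length_alternatingWord] at h3
    rw [← hw] at h2
    omega
  refine ⟨v, n, hn1, hv, hl, ?_, ?_⟩
  · by_cases he : Even n
    · simpa [he] using hprev
    · simpa [he] using hnext
  · by_cases he : Even n
    · simpa [he] using hnext
    · simpa [he] using hprev

theorem geomRep_simpleRoot_nonneg [Finite W] (cs : CoxeterSystem M W) (w : W) (s : B)
    (h : ¬cs.IsRightDescent w s) : 0 ≤ geomRep cs w (simpleRoot s) := by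
  induction hn : cs.length w using Nat.strong_induction_on generalizing w s with
  | _ N ih =>
  by_cases hw : w = 1
  · rw [hw, map_one]
    exact simpleRoot_nonneg s
  obtain ⟨t, ht⟩ := cs.exists_rightDescent_of_ne_one hw
  have hst : s ≠ t := by
    rintro rfl
    exact h ht
  have hM := coxeterMatrix_ne_zero cs s t
  obtain ⟨v, n, hn0, hv, hl, hvs, hvt⟩ := exists_maximal_alternating_suffix cs w s t ht
  have hnM : n + 1 ≤ M s t := by
    by_contra hlt
    refine cs.not_isReduced_alternatingWord t s (m := n + 1) (by rwa [M.symmetric])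
      (by rw [M.symmetric]; omega) ?_
    have hws : w * cs.simple s = v * cs.wordProd (alternatingWord t s (n + 1)) := by
      rw [alternatingWord_succ, cs.wordProd_concat, hv, mul_assoc]
    rw [cs.not_isRightDescent_iff, hws] at h
    have h2 := cs.length_mul_le v (cs.wordProd (alternatingWord t s (n + 1)))
    have h3 := cs.length_wordProd_le (alternatingWord t s (n + 1))
    rw [length_alternatingWord] at h3
    rw [CoxeterSystem.IsReduced, length_alternatingWord]
    omega
  set θ := Real.pi / M s t with hθ
  have hMpos : (0 : ℝ) < M s t := by exact_mod_cast Nat.pos_of_ne_zero hM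
  have hθM : (M s t : ℝ) * θ = Real.pi := by rw [hθ]; field_simp
  have hθ0 : 0 < θ := by positivity
  have hcast : (n : ℝ) + 1 ≤ M s t := by exact_mod_cast hnM
  have hn' : (1 : ℝ) ≤ n := by exact_mod_cast hn0
  have hle : n * θ + θ ≤ Real.pi := by nlinarith
  have hsin : 0 < Real.sin θ := Real.sin_pos_of_pos_of_lt_pi hθ0 (by nlinarith)
  have ha : 0 ≤ Real.sin (n * θ + θ) := Real.sin_nonneg_of_nonneg_of_le_pi (by positivity) hle
  have hb : 0 ≤ Real.sin (n * θ) :=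
    Real.sin_nonneg_of_nonneg_of_le_pi (by positivity) (by linarith)
  have hs0 := ih (cs.length v) (by omega) v s hvs rfl
  have ht0 := ih (cs.length v) (by omega) v t hvt rfl
  have key : 0 ≤ Real.sin θ • geomRep cs w (simpleRoot s) := by
    rw [hv, geomRep_mul_apply, ← map_smul, sin_smul_geomRep_alternatingWord, ← hθ]
    split_ifs
    · rw [map_add, map_smul, map_smul]
      exact add_nonneg (smul_nonneg ha hs0) (smul_nonneg hb ht0)
    · rw [map_add, map_smul, map_smul]
      exact add_nonneg (smul_nonneg hb hs0) (smul_nonneg ha ht0)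
  intro b
  have := key b
  simp only [Finsupp.coe_zero, Pi.zero_apply, Finsupp.smul_apply, smul_eq_mul] at this ⊢
  exact nonneg_of_mul_nonneg_right this hsin

theorem geomRep_simpleRoot_nonpos [Finite W] (cs : CoxeterSystem M W) (w : W) (s : B)
    (h : cs.IsRightDescent w s) : geomRep cs w (simpleRoot s) ≤ 0 := by
  have h1 := geomRep_simpleRoot_nonneg cs (w * cs.simple s) s
    (cs.isRightDescent_iff_not_isRightDescent_mul.1 h)
  rwa [geomRep_mul_apply, geomRep_simple_simpleRoot, map_neg, neg_nonneg] at h1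

/-- The roots of the geometric representation. -/
def IsRoot (cs : CoxeterSystem M W) (β : B →₀ ℝ) : Prop :=
  ∃ w s, geomRep cs w (simpleRoot s) = β

theorem isRoot_simpleRoot (cs : CoxeterSystem M W) (s : B) : IsRoot cs (simpleRoot s) :=
  ⟨1, s, by simp⟩

theorem IsRoot.map {cs : CoxeterSystem M W} {β : B →₀ ℝ} (h : IsRoot cs β) (w : W) :
    IsRoot cs (geomRep cs w β) := by
  obtain ⟨v, s, rfl⟩ := h
  exact ⟨w * v, s, geomRep_mul_apply cs w v _⟩

theorem IsRoot.neg {cs : CoxeterSystem M W} {β : B →₀ ℝ} (h : IsRoot cs β) : IsRoot cs (-β) := by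
  obtain ⟨v, s, rfl⟩ := h
  exact ⟨v * cs.simple s, s, by rw [geomRep_mul_apply, geomRep_simple_simpleRoot, map_neg]⟩

theorem IsRoot.form_self {cs : CoxeterSystem M W} {β : B →₀ ℝ} (h : IsRoot cs β) :
    form M β β = 1 := by
  obtain ⟨v, s, rfl⟩ := h
  rw [form_geomRep, bilin_simpleRoot, gram_self]

theorem IsRoot.ne_zero {cs : CoxeterSystem M W} {β : B →₀ ℝ} (h : IsRoot cs β) : β ≠ 0 := by
  rintro rfl
  simpa using h.form_self

theorem IsRoot.nonneg_or_nonpos [Finite W] {cs : CoxeterSystem M W} {β : B →₀ ℝ}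
    (h : IsRoot cs β) : 0 ≤ β ∨ β ≤ 0 := by
  obtain ⟨v, s, rfl⟩ := h
  by_cases hd : cs.IsRightDescent v s
  · exact Or.inr (geomRep_simpleRoot_nonpos cs v s hd)
  · exact Or.inl (geomRep_simpleRoot_nonneg cs v s hd)

theorem IsRoot.not_nonpos {cs : CoxeterSystem M W} {β : B →₀ ℝ} (h : IsRoot cs β)
    (h0 : 0 ≤ β) : ¬β ≤ 0 := fun h1 => h.ne_zero (le_antisymm h1 h0)

theorem IsRoot.nonneg_of_apply_pos [Finite W] {cs : CoxeterSystem M W} {β : B →₀ ℝ}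
    (h : IsRoot cs β) {t : B} (ht : 0 < β t) : 0 ≤ β :=
  h.nonneg_or_nonpos.resolve_right fun h1 => absurd (h1 t) (not_le.2 ht)

/-- A nonnegative root supported on `s` only is the simple root of `s`. -/
theorem IsRoot.eq_simpleRoot {cs : CoxeterSystem M W} {β : B →₀ ℝ} (h : IsRoot cs β)
    (h0 : 0 ≤ β) {s : B} (hs : ∀ t, t ≠ s → β t = 0) : β = simpleRoot s := by
  have hβ : β = β s • simpleRoot s := by
    ext t
    by_cases ht : t = s
    · subst ht
      simp [simpleRoot_apply_self]
    · simp [hs t ht, simpleRoot_apply_of_ne (Ne.symm ht)]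
  have h1 := h.form_self
  rw [hβ] at h1
  simp only [map_smul, LinearMap.smul_apply, bilin_simpleRoot, gram_self, smul_eq_mul] at h1
  have h2 : 0 ≤ β s := h0 s
  have h3 : β s = 1 := by nlinarith
  rw [hβ, h3, one_smul]

theorem IsRoot.geomRep_simple_nonneg [Finite W] {cs : CoxeterSystem M W} {β : B →₀ ℝ}
    (h : IsRoot cs β) (h0 : 0 ≤ β) {s : B} (hs : β ≠ simpleRoot s) :
    0 ≤ geomRep cs (cs.simple s) β := by
  obtain ⟨t, hts, ht⟩ : ∃ t, t ≠ s ∧ β t ≠ 0 := by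
    by_contra! hcon
    exact hs (h.eq_simpleRoot h0 hcon)
  refine (h.map _).nonneg_of_apply_pos (t := t) ?_
  rw [geomRep_simple_apply_of_ne cs hts]
  exact lt_of_le_of_ne (h0 t) (Ne.symm ht)

/-- The inversion set of `w`: the positive roots sent to negative roots by `w⁻¹`. -/
def inversions (cs : CoxeterSystem M W) (w : W) : Set (B →₀ ℝ) :=
  {β | IsRoot cs β ∧ 0 ≤ β ∧ geomRep cs w⁻¹ β ≤ 0}

theorem isLeftDescent_iff_simpleRoot_mem [Finite W] (cs : CoxeterSystem M W) (w : W) (s : B) :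
    cs.IsLeftDescent w s ↔ simpleRoot s ∈ inversions cs w := by
  rw [← cs.isRightDescent_inv_iff]
  constructor
  · intro h
    exact ⟨isRoot_simpleRoot cs s, simpleRoot_nonneg s, geomRep_simpleRoot_nonpos cs _ s h⟩
  · rintro ⟨h1, -, h3⟩
    by_contra h
    exact (h1.map _).not_nonpos (geomRep_simpleRoot_nonneg cs _ s h) h3

theorem inversions_one (cs : CoxeterSystem M W) : inversions cs 1 = ∅ := by
  ext β
  simp only [inversions, inv_one, map_one, Module.End.one_apply, Set.mem_ofPred_eq,
    Set.mem_empty_iff_false, iff_false]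
  rintro ⟨h1, h2, h3⟩
  exact h1.not_nonpos h2 h3

theorem eq_one_of_geomRep_eq_one [Finite W] (cs : CoxeterSystem M W) {w : W}
    (h : geomRep cs w = 1) : w = 1 := by
  by_contra hw
  obtain ⟨s, hs⟩ := cs.exists_rightDescent_of_ne_one hw
  have := geomRep_simpleRoot_nonpos cs w s hs
  rw [h] at this
  exact (isRoot_simpleRoot cs s).not_nonpos (simpleRoot_nonneg s) this

theorem geomRep_simple_mul_inv_apply (cs : CoxeterSystem M W) (w : W) (s : B) (x : B →₀ ℝ) :
    geomRep cs (cs.simple s * w)⁻¹ (geomRep cs (cs.simple s) x) = geomRep cs w⁻¹ x := by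
  rw [mul_inv_rev, cs.inv_simple, geomRep_mul_apply, geomRep_simple_simple_apply]

theorem isLeftDescent_mul_iff_not (cs : CoxeterSystem M W) (w : W) (s : B) :
    cs.IsLeftDescent (cs.simple s * w) s ↔ ¬cs.IsLeftDescent w s := by
  rw [cs.isLeftDescent_iff_not_isLeftDescent_mul (w := w), not_not]

theorem geomRep_simple_mem_inversions [Finite W] {cs : CoxeterSystem M W} {w : W} {s : B}
    {β : B →₀ ℝ} (h : β ∈ inversions cs w) (hs : β ≠ simpleRoot s) :
    geomRep cs (cs.simple s) β ∈ inversions cs (cs.simple s * w) :=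
  ⟨h.1.map _, h.1.geomRep_simple_nonneg h.2.1 hs, by
    rw [geomRep_simple_mul_inv_apply]
    exact h.2.2⟩

theorem geomRep_simple_mem_inversions_iff [Finite W] {cs : CoxeterSystem M W} {w : W} {s : B}
    {β : B →₀ ℝ} (hr : IsRoot cs β) (h0 : 0 ≤ β) (hs : β ≠ simpleRoot s) :
    geomRep cs (cs.simple s) β ∈ inversions cs (cs.simple s * w) ↔ β ∈ inversions cs w := by
  refine ⟨fun h => ⟨hr, h0, ?_⟩, fun h => geomRep_simple_mem_inversions h hs⟩
  rw [← geomRep_simple_mul_inv_apply cs w s]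
  exact h.2.2

theorem simpleRoot_notMem_inversions_mul [Finite W] {cs : CoxeterSystem M W} {w : W} {s : B}
    (h : cs.IsLeftDescent w s) : simpleRoot s ∉ inversions cs (cs.simple s * w) := by
  rw [← isLeftDescent_iff_simpleRoot_mem, isLeftDescent_mul_iff_not, not_not]
  exact h

/-- Inversions of `w` in terms of those of the shorter element `s w`. -/
theorem mem_inversions_iff_of_isLeftDescent [Finite W] {cs : CoxeterSystem M W} {w : W} {s : B}
    (h : cs.IsLeftDescent w s) {β : B →₀ ℝ} :
    β ∈ inversions cs w ↔
      β = simpleRoot s ∨ geomRep cs (cs.simple s) β ∈ inversions cs (cs.simple s * w) := by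
  by_cases hs : β = simpleRoot s
  · simp only [hs, true_or, iff_true]
    exact (isLeftDescent_iff_simpleRoot_mem cs w s).1 h
  · simp only [hs, false_or]
    constructor
    · intro hβ
      exact geomRep_simple_mem_inversions hβ hs
    · intro hβ
      have hne : geomRep cs (cs.simple s) β ≠ simpleRoot s := by
        intro h1
        rw [h1] at hβ
        exact simpleRoot_notMem_inversions_mul h hβ
      have := geomRep_simple_mem_inversions hβ hne
      rwa [geomRep_simple_simple_apply, cs.simple_mul_simple_cancel_left] at this

theorem inversions_simple_mul_subset_iff [Finite W] {cs : CoxeterSystem M W} {u v : W} {s : B}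
    (hu : cs.IsLeftDescent u s) (hv : cs.IsLeftDescent v s) :
    inversions cs (cs.simple s * u) ⊆ inversions cs (cs.simple s * v) ↔
      inversions cs u ⊆ inversions cs v := by
  constructor
  · intro h β hβ
    rw [mem_inversions_iff_of_isLeftDescent hu] at hβ
    rw [mem_inversions_iff_of_isLeftDescent hv]
    exact hβ.imp_right fun h1 => h h1
  · intro h β hβ
    have hne : β ≠ simpleRoot s := by
      rintro rfl
      exact simpleRoot_notMem_inversions_mul hu hβ
    have h1 := geomRep_simple_mem_inversions hβ hne
    rw [cs.simple_mul_simple_cancel_left] at h1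
    have h2 := (mem_inversions_iff_of_isLeftDescent hv).1 (h h1)
    rw [geomRep_simple_simple_apply] at h2
    refine h2.resolve_left fun h3 => ?_
    have h4 := hβ.2.1
    have h5 : β = -simpleRoot s := by
      rw [← geomRep_simple_simple_apply cs s β, h3, geomRep_simple_simpleRoot]
    rw [h5, neg_nonneg] at h4
    exact (isRoot_simpleRoot cs s).not_nonpos (simpleRoot_nonneg s) h4

theorem length_simple_mul_of_isLeftDescent {cs : CoxeterSystem M W} {w : W} {s : B}
    (h : cs.IsLeftDescent w s) : cs.length (cs.simple s * w) + 1 = cs.length w :=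
  cs.isLeftDescent_iff.1 h

theorem weakLE_simple_mul_iff {cs : CoxeterSystem M W} {u v : W} {s : B}
    (hu : cs.IsLeftDescent u s) (hv : cs.IsLeftDescent v s) :
    weakLE cs (cs.simple s * u) (cs.simple s * v) ↔ weakLE cs u v := by
  have h1 := length_simple_mul_of_isLeftDescent hu
  have h2 := length_simple_mul_of_isLeftDescent hv
  have h3 : (cs.simple s * u)⁻¹ * (cs.simple s * v) = u⁻¹ * v := by group
  rw [weakLE, weakLE, h3]
  omega

theorem IsLeftDescent.of_weakLE {cs : CoxeterSystem M W} {u v : W} {s : B}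
    (hu : cs.IsLeftDescent u s) (h : weakLE cs u v) : cs.IsLeftDescent v s := by
  have h1 := length_simple_mul_of_isLeftDescent hu
  have h2 := cs.length_mul_le (cs.simple s * u) (u⁻¹ * v)
  rw [mul_assoc, mul_inv_cancel_left] at h2
  rw [weakLE] at h
  rw [CoxeterSystem.IsLeftDescent]
  omega

theorem weakLE_iff_inversions_subset [Finite W] (cs : CoxeterSystem M W) (u v : W) :
    weakLE cs u v ↔ inversions cs u ⊆ inversions cs v := by
  induction hn : cs.length u generalizing u v with
  | zero =>
    rw [cs.length_eq_zero_iff] at hn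
    subst hn
    simp [weakLE, inversions_one]
  | succ n ih =>
    have hu : u ≠ 1 := by
      rintro rfl
      simp at hn
    obtain ⟨s, hs⟩ := cs.exists_leftDescent_of_ne_one hu
    have hl := length_simple_mul_of_isLeftDescent hs
    by_cases hv : cs.IsLeftDescent v s
    · rw [← weakLE_simple_mul_iff hs hv, ← inversions_simple_mul_subset_iff hs hv]
      exact ih _ _ (by omega)
    · constructor
      · intro h
        exact absurd (IsLeftDescent.of_weakLE hs h) hv
      · intro h
        refine absurd ?_ hv
        rw [isLeftDescent_iff_simpleRoot_mem] at hs ⊢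
        exact h hs

theorem inversions_injective [Finite W] (cs : CoxeterSystem M W) :
    Function.Injective (inversions cs) := by
  intro u v h
  have h1 := (weakLE_iff_inversions_subset cs u v).2 h.le
  have h2 := (weakLE_iff_inversions_subset cs v u).2 h.ge
  rw [weakLE] at h1 h2
  have h3 : u⁻¹ * v = 1 := cs.length_eq_zero_iff.1 (by omega)
  exact inv_mul_eq_one.1 h3

theorem isLeftDescent_of_length_maximal {cs : CoxeterSystem M W} {w₀ : W}
    (hw₀ : ∀ u : W, cs.length u ≤ cs.length w₀) (s : B) : cs.IsLeftDescent w₀ s := by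
  by_contra h
  rw [cs.not_isLeftDescent_iff] at h
  have := hw₀ (cs.simple s * w₀)
  omega

theorem inversions_of_forall_isLeftDescent [Finite W] {cs : CoxeterSystem M W} {w : W}
    (h : ∀ s, cs.IsLeftDescent w s) : inversions cs w = {β | IsRoot cs β ∧ 0 ≤ β} := by
  ext β
  refine ⟨fun hβ => ⟨hβ.1, hβ.2.1⟩, fun hβ => ⟨hβ.1, hβ.2, ?_⟩⟩
  have hsum : geomRep cs w⁻¹ β = β.sum fun s a => a • geomRep cs w⁻¹ (simpleRoot s) := by
    conv_lhs => rw [← Finsupp.sum_single β]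
    rw [Finsupp.sum, Finsupp.sum, map_sum]
    refine Finset.sum_congr rfl fun s _ => ?_
    rw [← map_smul, simpleRoot, Finsupp.smul_single, smul_eq_mul, mul_one]
  rw [hsum]
  exact Finset.sum_nonpos fun s _ => smul_nonpos_of_nonneg_of_nonpos (hβ.2 s)
    ((isLeftDescent_iff_simpleRoot_mem cs w s).1 (h s)).2.2

theorem eq_of_forall_isLeftDescent [Finite W] {cs : CoxeterSystem M W} {w₀ w : W}
    (hw₀ : ∀ u : W, cs.length u ≤ cs.length w₀) (h : ∀ s, cs.IsLeftDescent w s) : w = w₀ :=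
  inversions_injective cs <| by
    rw [inversions_of_forall_isLeftDescent h,
      inversions_of_forall_isLeftDescent (isLeftDescent_of_length_maximal hw₀)]

/-- Multiplication by the longest element complements the inversion set. -/
theorem mem_inversions_mul_longest_iff [Finite W] {cs : CoxeterSystem M W} {w₀ : W}
    (hw₀ : ∀ u : W, cs.length u ≤ cs.length w₀) (w : W) {β : B →₀ ℝ} (hr : IsRoot cs β)
    (h0 : 0 ≤ β) : β ∈ inversions cs (w * w₀) ↔ β ∉ inversions cs w := by
  have hall := inversions_of_forall_isLeftDescent (isLeftDescent_of_length_maximal hw₀)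
  have hneg : ∀ γ, IsRoot cs γ → 0 ≤ γ → geomRep cs w₀⁻¹ γ ≤ 0 := fun γ h1 h2 =>
    ((Set.ext_iff.1 hall γ).2 ⟨h1, h2⟩).2.2
  have hroot := hr.map w⁻¹
  have hmem : β ∈ inversions cs (w * w₀) ↔ geomRep cs w₀⁻¹ (geomRep cs w⁻¹ β) ≤ 0 := by
    rw [← geomRep_mul_apply, ← mul_inv_rev]
    exact ⟨fun h => h.2.2, fun h => ⟨hr, h0, h⟩⟩
  have hmem' : β ∈ inversions cs w ↔ geomRep cs w⁻¹ β ≤ 0 :=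
    ⟨fun h => h.2.2, fun h => ⟨hr, h0, h⟩⟩
  rw [hmem, hmem']
  constructor
  · intro h1 h2
    have h3 := hneg _ hroot.neg (neg_nonneg.2 h2)
    rw [map_neg, neg_nonpos] at h3
    exact (hroot.map w₀⁻¹).not_nonpos h3 h1
  · intro h
    exact hneg _ hroot (hroot.nonneg_or_nonpos.resolve_right h)

theorem isLeftDescent_mul_longest_iff [Finite W] {cs : CoxeterSystem M W} {w₀ : W}
    (hw₀ : ∀ u : W, cs.length u ≤ cs.length w₀) (w : W) (s : B) :
    cs.IsLeftDescent (w * w₀) s ↔ ¬cs.IsLeftDescent w s := by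
  rw [isLeftDescent_iff_simpleRoot_mem, isLeftDescent_iff_simpleRoot_mem,
    mem_inversions_mul_longest_iff hw₀ w (isRoot_simpleRoot cs s) (simpleRoot_nonneg s)]

/-- All inversions of `w` are supported on `J`, that is, `w` lies in the standard parabolic
subgroup of `J`. -/
def InParabolic (cs : CoxeterSystem M W) (J : Set B) (w : W) : Prop :=
  ∀ β ∈ inversions cs w, ∀ t, β t ≠ 0 → t ∈ J

theorem inParabolic_one (cs : CoxeterSystem M W) (J : Set B) : InParabolic cs J 1 := by
  intro β hβ
  rw [inversions_one] at hβ
  exact hβ.elim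

theorem InParabolic.mono {cs : CoxeterSystem M W} {J K : Set B} {w : W}
    (h : InParabolic cs J w) (hJK : J ⊆ K) : InParabolic cs K w :=
  fun β hβ t ht => hJK (h β hβ t ht)

theorem InParabolic.mem_of_isLeftDescent [Finite W] {cs : CoxeterSystem M W} {J : Set B} {w : W}
    (h : InParabolic cs J w) {r : B} (hr : cs.IsLeftDescent w r) : r ∈ J :=
  h _ ((isLeftDescent_iff_simpleRoot_mem cs w r).1 hr) r (by simp [simpleRoot_apply_self])

theorem InParabolic.simple_mul [Finite W] {cs : CoxeterSystem M W} {J : Set B} {w : W}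
    (h : InParabolic cs J w) {r : B} (hr : r ∈ J) : InParabolic cs J (cs.simple r * w) := by
  intro β hβ t ht
  by_cases htr : t = r
  · rwa [htr]
  · have hne : β ≠ simpleRoot r := by
      rintro rfl
      exact ht (simpleRoot_apply_of_ne (Ne.symm htr))
    have h1 := geomRep_simple_mem_inversions hβ hne
    rw [cs.simple_mul_simple_cancel_left] at h1
    refine h _ h1 t ?_
    rwa [geomRep_simple_apply_of_ne cs htr]

theorem InParabolic.of_isLeftDescent [Finite W] {cs : CoxeterSystem M W} {J : Set B} {w : W}
    (h : InParabolic cs J w) {r : B} (hr : cs.IsLeftDescent w r) :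
    InParabolic cs J (cs.simple r * w) :=
  h.simple_mul (h.mem_of_isLeftDescent hr)

theorem inParabolic_simple_mul_iff [Finite W] {cs : CoxeterSystem M W} {J : Set B} {w : W}
    {r : B} (hr : r ∈ J) : InParabolic cs J (cs.simple r * w) ↔ InParabolic cs J w := by
  refine ⟨fun h => ?_, fun h => h.simple_mul hr⟩
  have := h.simple_mul hr
  rwa [cs.simple_mul_simple_cancel_left] at this

/-! ### Reading a cyclic word -/

/-- `w` can be read along the infinite word `c^∞` in at most `n` steps, where skipping the
letter `s` requires the current remainder to lie in the parabolic subgroup of `{t | P s t}`. -/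
def ReadsIn (cs : CoxeterSystem M W) (P : B → B → Prop) : ℕ → List B → W → Prop
  | 0, _, w => w = 1
  | _ + 1, [], w => w = 1
  | n + 1, s :: c, w =>
    (cs.IsLeftDescent w s ∧ ReadsIn cs P n (c ++ [s]) (cs.simple s * w)) ∨
      (InParabolic cs {t | P s t} w ∧ ReadsIn cs P n (c ++ [s]) w)

/-- `w` can be read along `c^∞` in finitely many steps. -/
def Reads (cs : CoxeterSystem M W) (P : B → B → Prop) (c : List B) (w : W) : Prop :=
  ∃ n, ReadsIn cs P n c w

theorem reads_one (cs : CoxeterSystem M W) (P : B → B → Prop) (c : List B) : Reads cs P c 1 :=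
  ⟨0, rfl⟩

theorem ReadsIn.step {cs : CoxeterSystem M W} {P : B → B → Prop} {n : ℕ} {s : B} {c : List B}
    {w : W} (h : ReadsIn cs P n (s :: c) w) :
    (cs.IsLeftDescent w s ∧ ReadsIn cs P (n - 1) (c ++ [s]) (cs.simple s * w)) ∨
      (InParabolic cs {t | P s t} w ∧ ReadsIn cs P (n - 1) (c ++ [s]) w) := by
  cases n with
  | zero =>
    obtain rfl : w = 1 := h
    exact Or.inr ⟨inParabolic_one cs _, rfl⟩
  | succ n => exact h

theorem reads_cons_iff {cs : CoxeterSystem M W} {P : B → B → Prop} {s : B} {c : List B} {w : W} :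
    Reads cs P (s :: c) w ↔
      (cs.IsLeftDescent w s ∧ Reads cs P (c ++ [s]) (cs.simple s * w)) ∨
        (InParabolic cs {t | P s t} w ∧ Reads cs P (c ++ [s]) w) := by
  constructor
  · rintro ⟨n, h⟩
    exact h.step.imp (And.imp_right fun h => ⟨_, h⟩) (And.imp_right fun h => ⟨_, h⟩)
  · rintro (⟨h, n, hn⟩ | ⟨h, n, hn⟩)
    · exact ⟨n + 1, Or.inl ⟨h, hn⟩⟩
    · exact ⟨n + 1, Or.inr ⟨h, hn⟩⟩

theorem ReadsIn.mono {cs : CoxeterSystem M W} {P Q : B → B → Prop} (hPQ : ∀ s t, P s t → Q s t)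
    {n : ℕ} {c : List B} {w : W} (h : ReadsIn cs P n c w) : ReadsIn cs Q n c w := by
  induction n generalizing c w with
  | zero => exact h
  | succ n ih =>
    cases c with
    | nil => exact h
    | cons s c =>
      exact h.imp (And.imp_right ih) (And.imp (fun h => h.mono fun t ht => hPQ s t ht) ih)

theorem Reads.mono {cs : CoxeterSystem M W} {P Q : B → B → Prop} (hPQ : ∀ s t, P s t → Q s t)
    {c : List B} {w : W} (h : Reads cs P c w) : Reads cs Q c w :=
  h.imp fun _ => ReadsIn.mono hPQ

theorem ne_of_coxeterMatrix_eq_two {a b : B} (h : M a b = 2) : a ≠ b := by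
  rintro rfl
  simp at h

theorem geomRep_simple_apply_of_commute (cs : CoxeterSystem M W) {a b : B} (h : M a b = 2) :
    geomRep cs (cs.simple a) (simpleRoot b) = simpleRoot b := by
  rw [geomRep_simple_apply, bilin_simpleRoot, gram_eq_zero M h]
  simp

theorem isLeftDescent_simple_mul_of_commute [Finite W] (cs : CoxeterSystem M W) {a b : B}
    (h : M a b = 2) (w : W) : cs.IsLeftDescent (cs.simple a * w) b ↔ cs.IsLeftDescent w b := by
  rw [isLeftDescent_iff_simpleRoot_mem, isLeftDescent_iff_simpleRoot_mem]
  conv_lhs => rw [← geomRep_simple_apply_of_commute cs h]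
  refine geomRep_simple_mem_inversions_iff (isRoot_simpleRoot cs b) (simpleRoot_nonneg b) ?_
  intro hab
  have h1 := congrArg (fun v => v a) hab
  simp only [simpleRoot_apply_self, simpleRoot_apply_of_ne (ne_of_coxeterMatrix_eq_two h).symm]
    at h1
  exact zero_ne_one h1

theorem simple_mul_simple_comm (cs : CoxeterSystem M W) {a b : B} (h : M a b = 2) :
    cs.simple a * cs.simple b = cs.simple b * cs.simple a := by
  have h1 := cs.simple_mul_simple_pow a b
  rw [h, pow_two] at h1
  rw [mul_eq_one_iff_eq_inv] at h1
  rw [h1, mul_inv_rev, cs.inv_simple, cs.inv_simple]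

theorem Reads.of_commMove [Finite W] {cs : CoxeterSystem M W} {P : B → B → Prop}
    (hP : ∀ a b, M a b = 2 → P a b) {c c' : List B} (hc : CommMove M c c') {w : W}
    (h : Reads cs P c w) : Reads cs P c' w := by
  obtain ⟨n, h⟩ := h
  induction n using Nat.strong_induction_on generalizing c c' w with
  | _ n ih =>
  rcases Nat.eq_zero_or_pos n with rfl | hn
  · obtain rfl : w = 1 := h
    exact reads_one cs P c'
  obtain ⟨l₁, l₂, a, b, hab, rfl, rfl⟩ := hc
  have hba : M b a = 2 := by rwa [M.symmetric]
  cases l₁ with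
  | cons x l₁ =>
    have hmove : CommMove M (l₁ ++ a :: b :: l₂ ++ [x]) (l₁ ++ b :: a :: l₂ ++ [x]) :=
      ⟨l₁, l₂ ++ [x], a, b, hab, by simp, by simp⟩
    rw [List.cons_append] at h ⊢
    rw [reads_cons_iff]
    exact h.step.imp (And.imp_right (ih _ (by omega) hmove))
      (And.imp_right (ih _ (by omega) hmove))
  | nil =>
    simp only [List.nil_append] at h ⊢
    have hmove : CommMove M (l₂ ++ [a] ++ [b]) (l₂ ++ [b] ++ [a]) :=
      ⟨l₂, [], a, b, hab, by simp, by simp⟩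
    rcases h.step with ⟨ha, h⟩ | ⟨ha, h⟩ <;> rcases h.step with ⟨hb, h⟩ | ⟨hb, h⟩ <;>
      replace h := ih _ (by omega) hmove h
    · rw [isLeftDescent_simple_mul_of_commute cs hab] at hb
      refine reads_cons_iff.2 (Or.inl ⟨hb, reads_cons_iff.2 (Or.inl ⟨?_, ?_⟩)⟩)
      · rwa [isLeftDescent_simple_mul_of_commute cs hba]
      · rwa [← mul_assoc, simple_mul_simple_comm cs hab, mul_assoc]
    · rw [inParabolic_simple_mul_iff (show a ∈ {t | P b t} from hP b a hba)] at hb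
      exact reads_cons_iff.2 (Or.inr ⟨hb, reads_cons_iff.2 (Or.inl ⟨ha, h⟩)⟩)
    · exact reads_cons_iff.2 (Or.inl ⟨hb, reads_cons_iff.2
        (Or.inr ⟨ha.of_isLeftDescent hb, h⟩)⟩)
    · exact reads_cons_iff.2 (Or.inr ⟨hb, reads_cons_iff.2 (Or.inr ⟨ha, h⟩)⟩)

/-- A property invariant under commutation moves does not see a letter moving through letters
commuting with it. -/
theorem iff_of_forall_commMove {Q : List B → Prop}
    (hQ : ∀ l l', CommMove M l l' → Q l → Q l') {r : B} (p a b : List B)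
    (ha : ∀ s ∈ a, M s r = 2) : Q (p ++ r :: (a ++ b)) ↔ Q (p ++ (a ++ r :: b)) := by
  induction a generalizing p with
  | nil => rfl
  | cons x a ih =>
    have hx : M x r = 2 := ha x (by simp)
    have hx' : M r x = 2 := by rwa [M.symmetric]
    have h1 : Q (p ++ r :: (x :: a ++ b)) ↔ Q (p ++ x :: r :: (a ++ b)) :=
      ⟨hQ _ _ ⟨p, a ++ b, r, x, hx', by simp, rfl⟩, hQ _ _ ⟨p, a ++ b, x, r, hx, rfl, by simp⟩⟩
    have h2 := ih (p ++ [x]) fun s hs => ha s (by simp [hs])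
    rw [h1]
    simpa using h2

/-! ### Words listing every generator once -/

/-- The word `c` contains every letter exactly once. -/
def IsEnumeration (c : List B) : Prop := c.Nodup ∧ ∀ b, b ∈ c

theorem IsEnumeration.perm {c d : List B} (h : IsEnumeration c) (hp : c.Perm d) :
    IsEnumeration d :=
  ⟨hp.nodup_iff.1 h.1, fun b => hp.mem_iff.1 (h.2 b)⟩

theorem IsEnumeration.rotate {s : B} {c : List B} (h : IsEnumeration (s :: c)) :
    IsEnumeration (c ++ [s]) :=
  h.perm (List.perm_append_singleton s c).symm

theorem IsEnumeration.rotate_symm {s : B} {c : List B} (h : IsEnumeration (c ++ [s])) :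
    IsEnumeration (s :: c) :=
  h.perm (List.perm_append_singleton s c)

theorem IsEnumeration.reverse {c : List B} (h : IsEnumeration c) : IsEnumeration c.reverse :=
  h.perm (List.reverse_perm c).symm

theorem CommMove.perm {c d : List B} (h : CommMove M c d) : c.Perm d := by
  obtain ⟨l₁, l₂, a, b, -, rfl, rfl⟩ := h
  exact (List.Perm.swap b a l₂).append_left l₁

theorem CommMove.reverse {c d : List B} (h : CommMove M c d) :
    CommMove M c.reverse d.reverse := by
  obtain ⟨l₁, l₂, a, b, hab, rfl, rfl⟩ := h
  exact ⟨l₂.reverse, l₁.reverse, b, a, by rwa [M.symmetric], by simp, by simp⟩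

/-! ### Sortable elements as readable elements -/

theorem pass_eq (cs : CoxeterSystem M W) (p : List B) (c : List B) (u : W) :
    c.foldl (fun p q =>
      if cs.length (cs.simple q * p.2) < cs.length p.2 then (p.1 ++ [q], cs.simple q * p.2)
      else p) (p, u) = (p ++ (pass cs c u).1, (pass cs c u).2) := by
  induction c generalizing p u with
  | nil => simp [pass]
  | cons s c ih =>
    rw [pass, List.foldl_cons, List.foldl_cons]
    by_cases h : cs.length (cs.simple s * u) < cs.length u
    · simp only [if_pos h, List.nil_append]
      rw [ih, ih]
      simp
    · simp only [if_neg h]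
      rw [ih, ih]
      simp

theorem pass_nil (cs : CoxeterSystem M W) (u : W) : pass cs [] u = ([], u) := rfl

theorem pass_cons_of_isLeftDescent (cs : CoxeterSystem M W) {s : B} (c : List B) {u : W}
    (h : cs.IsLeftDescent u s) :
    pass cs (s :: c) u =
      (s :: (pass cs c (cs.simple s * u)).1, (pass cs c (cs.simple s * u)).2) := by
  conv_lhs => rw [pass, List.foldl_cons]
  simp only [if_pos (show cs.length (cs.simple s * u) < cs.length u from h), List.nil_append]
  rw [pass_eq]
  rfl

theorem pass_cons_of_not_isLeftDescent (cs : CoxeterSystem M W) {s : B} (c : List B) {u : W}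
    (h : ¬cs.IsLeftDescent u s) : pass cs (s :: c) u = pass cs c u := by
  conv_lhs => rw [pass, List.foldl_cons]
  simp only [if_neg (show ¬cs.length (cs.simple s * u) < cs.length u from h)]
  rfl

theorem pass_append (cs : CoxeterSystem M W) (c d : List B) (u : W) :
    pass cs (c ++ d) u =
      ((pass cs c u).1 ++ (pass cs d (pass cs c u).2).1, (pass cs d (pass cs c u).2).2) := by
  conv_lhs => rw [pass, List.foldl_append]
  exact pass_eq cs _ d _

theorem mem_of_mem_pass (cs : CoxeterSystem M W) {c : List B} {u : W} {q : B}
    (h : q ∈ (pass cs c u).1) : q ∈ c := by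
  induction c generalizing u with
  | nil => simp [pass_nil] at h
  | cons s c ih =>
    by_cases hs : cs.IsLeftDescent u s
    · rw [pass_cons_of_isLeftDescent cs c hs, List.mem_cons] at h
      exact List.mem_cons.2 (h.imp_right ih)
    · rw [pass_cons_of_not_isLeftDescent cs c hs] at h
      exact List.mem_cons_of_mem s (ih h)

theorem mem_pass_singleton_iff (cs : CoxeterSystem M W) {s q : B} {u : W} :
    q ∈ (pass cs [s] u).1 ↔ q = s ∧ cs.IsLeftDescent u s := by
  by_cases h : cs.IsLeftDescent u s
  · simp [pass_cons_of_isLeftDescent cs [] h, pass_nil, h]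
  · simp [pass_cons_of_not_isLeftDescent cs [] h, pass_nil, h]

theorem pass_one (cs : CoxeterSystem M W) (c : List B) : pass cs c 1 = ([], 1) := by
  induction c with
  | nil => rfl
  | cons s c ih => rw [pass_cons_of_not_isLeftDescent cs c (cs.not_isLeftDescent_one s), ih]

theorem inParabolic_pass [Finite W] {cs : CoxeterSystem M W} {J : Set B} {u : W}
    (h : InParabolic cs J u) (c : List B) : InParabolic cs J (pass cs c u).2 := by
  induction c generalizing u with
  | nil => exact h
  | cons s c ih =>
    by_cases hs : cs.IsLeftDescent u s
    · rw [pass_cons_of_isLeftDescent cs c hs]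
      exact ih (h.of_isLeftDescent hs)
    · rw [pass_cons_of_not_isLeftDescent cs c hs]
      exact ih h

theorem InParabolic.of_pass [Finite W] {cs : CoxeterSystem M W} {J : Set B} {u : W} {c : List B}
    (h : InParabolic cs J (pass cs c u).2) (hc : ∀ q ∈ (pass cs c u).1, q ∈ J) :
    InParabolic cs J u := by
  induction c generalizing u with
  | nil => exact h
  | cons s c ih =>
    by_cases hs : cs.IsLeftDescent u s
    · rw [pass_cons_of_isLeftDescent cs c hs] at h hc
      rw [← inParabolic_simple_mul_iff (hc s (by simp))]
      exact ih h fun q hq => hc q (by simp [hq])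
    · rw [pass_cons_of_not_isLeftDescent cs c hs] at h hc
      exact ih h hc

theorem length_pass_le (cs : CoxeterSystem M W) (c : List B) (u : W) :
    cs.length (pass cs c u).2 ≤ cs.length u := by
  induction c generalizing u with
  | nil => exact le_rfl
  | cons s c ih =>
    by_cases hs : cs.IsLeftDescent u s
    · rw [pass_cons_of_isLeftDescent cs c hs]
      exact (ih _).trans hs.le
    · rw [pass_cons_of_not_isLeftDescent cs c hs]
      exact ih u

theorem length_pass_lt (cs : CoxeterSystem M W) {c : List B} {u : W} {s : B} (hs : s ∈ c)
    (h : cs.IsLeftDescent u s) : cs.length (pass cs c u).2 < cs.length u := by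
  induction c with
  | nil => simp at hs
  | cons x c ih =>
    by_cases hx : cs.IsLeftDescent u x
    · rw [pass_cons_of_isLeftDescent cs c hx]
      exact (length_pass_le cs c _).trans_lt hx
    · rw [pass_cons_of_not_isLeftDescent cs c hx]
      refine ih ((List.mem_cons.1 hs).resolve_left ?_)
      rintro rfl
      exact hx h

theorem length_remainder_le (cs : CoxeterSystem M W) {c : List B} (hc : ∀ b, b ∈ c) (w : W)
    (n : ℕ) : cs.length (remainder cs c w n) ≤ cs.length w - n := by
  induction n with
  | zero => simp [remainder]
  | succ n ih =>
    rw [remainder]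
    by_cases h1 : remainder cs c w n = 1
    · simp [h1, pass_one]
    · obtain ⟨s, hs⟩ := cs.exists_leftDescent_of_ne_one h1
      have := length_pass_lt cs (hc s) hs
      omega

theorem remainder_length_eq_one (cs : CoxeterSystem M W) {c : List B} (hc : ∀ b, b ∈ c) (w : W) :
    remainder cs c w (cs.length w) = 1 := by
  have := length_remainder_le cs hc w (cs.length w)
  rw [← cs.length_eq_zero_iff]
  omega

theorem isSortable_one (cs : CoxeterSystem M W) (c : List B) : IsSortable cs c 1 := by
  have h : ∀ n, remainder cs c 1 n = 1 := by
    intro n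
    induction n with
    | zero => rfl
    | succ n ih => rw [remainder, ih, pass_one]
  intro n q hq
  rw [factor, h, pass_one] at hq
  simp at hq

theorem remainder_rotate (cs : CoxeterSystem M W) (s : B) (c : List B) (w : W) (n : ℕ) :
    remainder cs (c ++ [s]) (pass cs [s] w).2 n =
      (pass cs [s] (remainder cs (s :: c) w n)).2 := by
  induction n with
  | zero => rfl
  | succ n ih =>
    rw [remainder, ih, pass_append, remainder, show s :: c = [s] ++ c from rfl, pass_append]

theorem isSortable_cons_iff_rotate (cs : CoxeterSystem M W) {s : B} {c : List B} (hs : s ∉ c)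
    (w : W) : IsSortable cs (s :: c) w ↔
      IsSortable cs (c ++ [s]) (pass cs [s] w).2 ∧
        (cs.IsLeftDescent (remainder cs (s :: c) w 1) s → cs.IsLeftDescent w s) := by
  set r := remainder cs (s :: c) w with hr
  have hr' : ∀ n, r (n + 1) = (pass cs c (pass cs [s] (r n)).2).2 := by
    intro n
    rw [hr, remainder, show s :: c = [s] ++ c from rfl, pass_append]
  have hF : ∀ n q, q ∈ factor cs (s :: c) w n ↔
      (q = s ∧ cs.IsLeftDescent (r n) s) ∨ q ∈ (pass cs c (pass cs [s] (r n)).2).1 := by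
    intro n q
    rw [factor, ← hr, show s :: c = [s] ++ c from rfl, pass_append, List.mem_append,
      mem_pass_singleton_iff]
  have hG : ∀ n q, q ∈ factor cs (c ++ [s]) (pass cs [s] w).2 n ↔
      q ∈ (pass cs c (pass cs [s] (r n)).2).1 ∨ (q = s ∧ cs.IsLeftDescent (r (n + 1)) s) := by
    intro n q
    rw [factor, remainder_rotate, pass_append, List.mem_append, mem_pass_singleton_iff, ← hr, hr']
  have hnot : ∀ n, s ∉ (pass cs c (pass cs [s] (r n)).2).1 := fun n h =>
    hs (mem_of_mem_pass cs h)
  constructor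
  · intro h
    refine ⟨fun n q => ?_, ?_⟩
    · rw [hG, hG]
      by_cases hq : q = s
      · subst hq
        have := h (n + 1) q
        rw [hF, hF] at this
        have h1 := hnot (n + 1)
        have h2 := hnot (n + 1 + 1)
        tauto
      · have := h n q
        rw [hF, hF] at this
        tauto
    · have := h 0 s
      rw [hF, hF] at this
      have h1 := hnot 0
      change _ → cs.IsLeftDescent (r 0) s
      tauto
  · rintro ⟨h, h0⟩ n q
    rw [hF, hF]
    by_cases hq : q = s
    · subst hq
      cases n with
      | zero =>
        have h1 := hnot (0 + 1)
        change _ → cs.IsLeftDescent (r 0) q at h0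
        tauto
      | succ n =>
        have := h n q
        rw [hG, hG] at this
        have h1 := hnot n
        have h2 := hnot (n + 1 + 1)
        tauto
    · have := h n q
      rw [hG, hG] at this
      tauto

theorem isSortable_cons_iff [Finite W] (cs : CoxeterSystem M W) {s : B} {c : List B}
    (hc : IsEnumeration (s :: c)) (w : W) : IsSortable cs (s :: c) w ↔
      (cs.IsLeftDescent w s ∧ IsSortable cs (c ++ [s]) (cs.simple s * w)) ∨
        (InParabolic cs {t | t ≠ s} w ∧ IsSortable cs (c ++ [s]) w) := by
  have hs : s ∉ c := (List.nodup_cons.1 hc.1).1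
  by_cases hw : cs.IsLeftDescent w s
  · have hnot : ¬InParabolic cs {t | t ≠ s} w := fun h => h.mem_of_isLeftDescent hw rfl
    rw [isSortable_cons_iff_rotate cs hs, pass_cons_of_isLeftDescent cs [] hw, pass_nil]
    tauto
  · have hpass : (pass cs [s] w).2 = w := by
      rw [pass_cons_of_not_isLeftDescent cs [] hw, pass_nil]
    simp only [hw, false_and, false_or]
    constructor
    · intro h
      have h1 : ∀ n, ¬cs.IsLeftDescent (remainder cs (s :: c) w n) s := by
        intro n
        induction n with
        | zero => exact hw
        | succ n ih =>
          intro hd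
          have hmem : ∀ m, cs.IsLeftDescent (remainder cs (s :: c) w m) s ↔
              s ∈ factor cs (s :: c) w m := by
            intro m
            rw [factor, show s :: c = [s] ++ c from rfl, pass_append, List.mem_append,
              mem_pass_singleton_iff]
            have : s ∉ (pass cs c (pass cs [s] (remainder cs ([s] ++ c) w m)).2).1 :=
              fun h => hs (mem_of_mem_pass cs h)
            tauto
          rw [hmem] at hd ih
          exact ih (h n s hd)
      have h2 : ∀ n, InParabolic cs {t | t ≠ s} (remainder cs (s :: c) w n) →
          InParabolic cs {t | t ≠ s} w := by
        intro n
        induction n with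
        | zero => exact id
        | succ n ih =>
          intro hn
          refine ih (InParabolic.of_pass hn ?_)
          rw [pass_cons_of_not_isLeftDescent cs c (h1 n)]
          rintro q hq rfl
          exact hs (mem_of_mem_pass cs hq)
      refine ⟨h2 (cs.length w) ?_, ?_⟩
      · rw [remainder_length_eq_one cs hc.2]
        exact inParabolic_one cs _
      · rw [isSortable_cons_iff_rotate cs hs, hpass] at h
        exact h.1
    · rintro ⟨hp, h⟩
      rw [isSortable_cons_iff_rotate cs hs, hpass]
      exact ⟨h, fun hd => absurd rfl ((inParabolic_pass hp (s :: c)).mem_of_isLeftDescent hd)⟩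

theorem IsSortable.reads [Finite W] {cs : CoxeterSystem M W} {c : List B}
    (hc : IsEnumeration c) {w : W} (h : IsSortable cs c w) :
    Reads cs (fun s t => t ≠ s) c w := by
  suffices H : ∀ n, ∀ w : W, cs.length w = n → ∀ l l' : List B, IsEnumeration (l ++ l') →
      IsSortable cs (l ++ l') w → (∀ x ∈ l', ¬cs.IsLeftDescent w x) →
      Reads cs (fun s t => t ≠ s) (l ++ l') w by
    simpa using H _ w rfl c [] (by simpa using hc) (by simpa using h) (by simp)
  intro n
  induction n using Nat.strong_induction_on with
  | _ n ih =>
  intro w hw l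
  induction l with
  | nil =>
    intro l' hl' _ hx
    have : w = 1 := by
      by_contra h1
      obtain ⟨s, hs⟩ := cs.exists_leftDescent_of_ne_one h1
      exact hx s (by simpa using hl'.2 s) hs
    rw [this]
    exact reads_one cs _ _
  | cons s l ihl =>
    intro l' hl' hsort hx
    rw [List.cons_append] at hl' hsort ⊢
    rw [isSortable_cons_iff cs hl'] at hsort
    rw [reads_cons_iff]
    refine hsort.imp ?_ ?_
    · rintro ⟨hd, h⟩
      have := length_simple_mul_of_isLeftDescent hd
      refine ⟨hd, ?_⟩
      simpa using ih _ (by omega) _ rfl (l ++ l' ++ [s]) [] (by simpa using hl'.rotate)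
        (by simpa using h) (by simp)
    · rintro ⟨hp, h⟩
      refine ⟨hp, ?_⟩
      have := ihl (l' ++ [s]) (by simpa using hl'.rotate) (by simpa using h) (by
        intro x hxm
        rw [List.mem_append, List.mem_singleton] at hxm
        rcases hxm with hxm | rfl
        · exact hx x hxm
        · exact fun hd => hp.mem_of_isLeftDescent hd rfl)
      simpa using this

theorem Reads.isSortable [Finite W] {cs : CoxeterSystem M W} {c : List B}
    (hc : IsEnumeration c) {w : W} (h : Reads cs (fun s t => t ≠ s) c w) :
    IsSortable cs c w := by
  obtain ⟨n, h⟩ := h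
  induction n generalizing c w with
  | zero =>
    obtain rfl : w = 1 := h
    exact isSortable_one cs c
  | succ n ih =>
    cases c with
    | nil =>
      obtain rfl : w = 1 := h
      exact isSortable_one cs _
    | cons s c =>
      rw [isSortable_cons_iff cs hc]
      exact h.imp (And.imp_right (ih hc.rotate)) (And.imp_right (ih hc.rotate))

theorem isSortable_iff_reads [Finite W] {cs : CoxeterSystem M W} {c : List B}
    (hc : IsEnumeration c) {w : W} :
    IsSortable cs c w ↔ Reads cs (fun s t => t ≠ s) c w :=
  ⟨fun h => h.reads hc, fun h => h.isSortable hc⟩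

theorem IsSortable.of_commMove [Finite W] {cs : CoxeterSystem M W} {c c' : List B}
    (hc : IsEnumeration c) (hm : CommMove M c c') {w : W} (h : IsSortable cs c w) :
    IsSortable cs c' w := by
  rw [isSortable_iff_reads hc] at h
  rw [isSortable_iff_reads (hc.perm hm.perm)]
  exact h.of_commMove (fun a b hab => (ne_of_coxeterMatrix_eq_two hab).symm) hm

/-! ### The skew form attached to an enumeration of the generators -/

open Classical in
/-- The coefficients of the skew form attached to the word `c`. -/
def skewCoeff (M : CoxeterMatrix B) (c : List B) (s t : B) : ℝ :=
  if c.idxOf s < c.idxOf t then -gram M s t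
  else if c.idxOf t < c.idxOf s then gram M s t else 0

/-- The skew form attached to the word `c`. -/
abbrev skewForm (M : CoxeterMatrix B) (c : List B) : (B →₀ ℝ) →ₗ[ℝ] (B →₀ ℝ) →ₗ[ℝ] ℝ :=
  bilin (skewCoeff M c)

theorem skewCoeff_swap (M : CoxeterMatrix B) (c : List B) (s t : B) :
    skewCoeff M c s t = -skewCoeff M c t s := by
  classical
  simp only [skewCoeff, gram_comm M t s]
  split_ifs <;> first | omega | simp

theorem skewForm_swap (M : CoxeterMatrix B) (c : List B) (x y : B →₀ ℝ) :
    skewForm M c x y = -skewForm M c y x := by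
  have : skewForm M c = -(skewForm M c).flip :=
    bilin_hom_ext fun s t => by simpa using skewCoeff_swap M c s t
  conv_lhs => rw [this]
  rfl

theorem skewCoeff_self (M : CoxeterMatrix B) (c : List B) (s : B) : skewCoeff M c s s = 0 := by
  simp [skewCoeff]

theorem skewForm_self (M : CoxeterMatrix B) (c : List B) (x : B →₀ ℝ) :
    skewForm M c x x = 0 := by
  have := skewForm_swap M c x x
  linarith

theorem skewCoeff_cons_self (M : CoxeterMatrix B) {s t : B} (c : List B) (h : t ≠ s) :
    skewCoeff M (s :: c) s t = -gram M s t := by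
  classical
  simp [skewCoeff, List.idxOf_cons_ne _ h.symm]

theorem skewCoeff_append_self (M : CoxeterMatrix B) {s t : B} {c : List B}
    (hc : IsEnumeration (s :: c)) (h : t ≠ s) :
    skewCoeff M (c ++ [s]) s t = gram M s t := by
  classical
  have hs : s ∉ c := (List.nodup_cons.1 hc.1).1
  have ht : t ∈ c := (List.mem_cons.1 (hc.2 t)).resolve_left h
  have h1 : (c ++ [s]).idxOf t = c.idxOf t := List.idxOf_append_of_mem ht
  have h2 : (c ++ [s]).idxOf s = c.length := by
    rw [List.idxOf_append_of_notMem hs]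
    simp
  have h3 : c.idxOf t < c.length := List.idxOf_lt_length_of_mem ht
  rw [skewCoeff, h1, h2, if_neg (by omega), if_pos h3]

theorem skewCoeff_append_of_ne (M : CoxeterMatrix B) {s t u : B} {c : List B}
    (hc : IsEnumeration (s :: c)) (ht : t ≠ s) (hu : u ≠ s) :
    skewCoeff M (c ++ [s]) t u = skewCoeff M (s :: c) t u := by
  classical
  have htc : t ∈ c := (List.mem_cons.1 (hc.2 t)).resolve_left ht
  have huc : u ∈ c := (List.mem_cons.1 (hc.2 u)).resolve_left hu
  simp only [skewCoeff, List.idxOf_append_of_mem htc, List.idxOf_append_of_mem huc,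
    List.idxOf_cons_ne _ ht.symm, List.idxOf_cons_ne _ hu.symm, Nat.succ_eq_add_one,
    Nat.add_lt_add_iff_right]

theorem skewForm_cons_simpleRoot (M : CoxeterMatrix B) (s : B) (c : List B) (x : B →₀ ℝ) :
    skewForm M (s :: c) (simpleRoot s) x = x s - form M (simpleRoot s) x := by
  have : skewForm M (s :: c) (simpleRoot s) = Finsupp.lapply s - form M (simpleRoot s) := by
    refine linear_hom_ext fun t => ?_
    simp only [bilin_simpleRoot, LinearMap.sub_apply, Finsupp.lapply_apply]
    by_cases h : t = s
    · subst h
      rw [skewCoeff_self, gram_self, simpleRoot_apply_self, sub_self]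
    · rw [skewCoeff_cons_self M c h, simpleRoot_apply_of_ne h, zero_sub]
  rw [this]
  rfl

theorem form_simpleRoot_eq [DecidableEq B] (M : CoxeterMatrix B) (s : B) (x : B →₀ ℝ) :
    x s - form M (simpleRoot s) x = ∑ t ∈ x.support.erase s, x t * -gram M s t := by
  rw [bilin_simpleRoot_left, Finsupp.sum, Finset.sum_congr rfl fun t _ => mul_neg _ _,
    Finset.sum_neg_distrib]
  by_cases hs : s ∈ x.support
  · rw [← Finset.add_sum_erase _ _ hs, gram_self]
    ring
  · rw [Finset.erase_eq_of_notMem hs, Finsupp.notMem_support_iff.1 hs, zero_sub]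

theorem skewForm_cons_nonneg (M : CoxeterMatrix B) (s : B) (c : List B) {x : B →₀ ℝ}
    (hx : 0 ≤ x) : 0 ≤ skewForm M (s :: c) (simpleRoot s) x := by
  classical
  rw [skewForm_cons_simpleRoot, form_simpleRoot_eq]
  exact Finset.sum_nonneg fun t ht =>
    mul_nonneg (hx t) (neg_nonneg.2 (gram_nonpos M (Finset.ne_of_mem_erase ht).symm))

theorem coxeterMatrix_eq_two_of_skewForm_cons_eq_zero {s : B} {c : List B} {x : B →₀ ℝ}
    (hx : 0 ≤ x) (h : skewForm M (s :: c) (simpleRoot s) x = 0) {t : B} (hts : t ≠ s)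
    (ht : x t ≠ 0) : M s t = 2 := by
  classical
  rw [skewForm_cons_simpleRoot, form_simpleRoot_eq] at h
  have h1 := (Finset.sum_eq_zero_iff_of_nonneg fun t ht =>
    mul_nonneg (hx t) (neg_nonneg.2 (gram_nonpos M (Finset.ne_of_mem_erase ht).symm))).1 h t
    (by simp [hts, ht])
  refine eq_two_of_gram_eq_zero M hts.symm ?_
  simpa [ht] using h1

theorem skewForm_rotate {s : B} {c : List B} (hc : IsEnumeration (s :: c)) (x y : B →₀ ℝ) :
    skewForm M (c ++ [s]) x y = skewForm M (s :: c) x y -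
      2 * x s * skewForm M (s :: c) (simpleRoot s) y -
      2 * y s * skewForm M (s :: c) x (simpleRoot s) := by
  have : skewForm M (c ++ [s]) = skewForm M (s :: c) -
      (2 : ℝ) • (Finsupp.lapply s).smulRight (skewForm M (s :: c) (simpleRoot s)) -
      (2 : ℝ) • ((Finsupp.lapply s).smulRight
        ((skewForm M (s :: c)).flip (simpleRoot s))).flip := by
    refine bilin_hom_ext fun a b => ?_
    simp only [bilin_simpleRoot, LinearMap.sub_apply, LinearMap.smul_apply,
      LinearMap.smulRight_apply, LinearMap.flip_apply, Finsupp.lapply_apply, smul_eq_mul]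
    by_cases ha : a = s <;> by_cases hb : b = s
    · subst ha hb
      simp only [skewCoeff_self]
      ring
    · subst ha
      rw [skewCoeff_append_self M hc hb, skewCoeff_cons_self M c hb, simpleRoot_apply_self,
        simpleRoot_apply_of_ne hb]
      ring
    · subst hb
      rw [skewCoeff_swap, skewCoeff_append_self M hc ha, skewCoeff_swap M _ a b,
        skewCoeff_cons_self M c ha, simpleRoot_apply_self, simpleRoot_apply_of_ne ha]
      ring
    · rw [skewCoeff_append_of_ne M hc ha hb, simpleRoot_apply_of_ne ha,
        simpleRoot_apply_of_ne hb]
      ring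
  rw [this]
  simp only [LinearMap.sub_apply, LinearMap.smul_apply, LinearMap.smulRight_apply,
    LinearMap.flip_apply, Finsupp.lapply_apply, smul_eq_mul]
  ring

theorem skewForm_rotate_of_apply_eq_zero {s : B} {c : List B} (hc : IsEnumeration (s :: c))
    {x y : B →₀ ℝ} (hx : x s = 0) (hy : y s = 0) :
    skewForm M (c ++ [s]) x y = skewForm M (s :: c) x y := by
  rw [skewForm_rotate hc, hx, hy]
  ring

theorem skewForm_append_simpleRoot {s : B} {c : List B} (hc : IsEnumeration (s :: c))
    (y : B →₀ ℝ) :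
    skewForm M (c ++ [s]) (simpleRoot s) y = -skewForm M (s :: c) (simpleRoot s) y := by
  rw [skewForm_rotate hc, simpleRoot_apply_self, skewForm_self]
  ring

/-- Conjugating the enumeration by its first letter corresponds to a simple reflection. -/
theorem skewForm_rotate_geomRep (cs : CoxeterSystem M W) {s : B} {c : List B}
    (hc : IsEnumeration (s :: c)) (x y : B →₀ ℝ) :
    skewForm M (c ++ [s]) (geomRep cs (cs.simple s) x) (geomRep cs (cs.simple s) y) =
      skewForm M (s :: c) x y := by
  have h0 : skewForm M (c ++ [s]) x (simpleRoot s) = skewForm M (s :: c) (simpleRoot s) x := by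
    rw [skewForm_swap, skewForm_append_simpleRoot hc, neg_neg]
  simp only [geomRep_simple_apply, map_sub, map_smul, LinearMap.sub_apply, LinearMap.smul_apply,
    smul_eq_mul, h0, skewForm_append_simpleRoot hc, skewForm_self]
  rw [skewForm_rotate hc, skewForm_swap M (s :: c) x (simpleRoot s)]
  simp only [skewForm_cons_simpleRoot]
  ring

/-- Sortable elements are aligned with respect to the skew form. -/
theorem mem_inversions_of_skewForm_pos [Finite W] {cs : CoxeterSystem M W} {c : List B}
    (hc : IsEnumeration c) {v : W} (h : Reads cs (fun s t => t ≠ s) c v) {β γ : B →₀ ℝ}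
    (hβ : IsRoot cs β) (hβ0 : 0 ≤ β) (hγ : IsRoot cs γ) (hγ0 : 0 ≤ γ) {p q : ℝ} (hp : 0 < p)
    (hq : 0 < q) (hpos : 0 < skewForm M c β γ) (hmem : p • β + q • γ ∈ inversions cs v) :
    β ∈ inversions cs v := by
  obtain ⟨n, h⟩ := h
  induction n generalizing c v β γ with
  | zero =>
    obtain rfl : v = 1 := h
    rw [inversions_one] at hmem
    exact hmem.elim
  | succ n ih =>
    cases c with
    | nil =>
      obtain rfl : v = 1 := h
      rw [inversions_one] at hmem
      exact hmem.elim
    | cons s c =>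
      rcases h with ⟨hs, h⟩ | ⟨hs, h⟩
      · rw [mem_inversions_iff_of_isLeftDescent hs]
        by_cases hβs : β = simpleRoot s
        · exact Or.inl hβs
        · have hγs : γ ≠ simpleRoot s := by
            rintro rfl
            rw [skewForm_swap] at hpos
            have := skewForm_cons_nonneg M s c hβ0
            linarith
          have hβ1 := hβ.geomRep_simple_nonneg hβ0 hβs
          have hγ1 := hγ.geomRep_simple_nonneg hγ0 hγs
          have hmap : geomRep cs (cs.simple s) (p • β + q • γ) =
              p • geomRep cs (cs.simple s) β + q • geomRep cs (cs.simple s) γ := by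
            rw [map_add, map_smul, map_smul]
          have hδs : p • β + q • γ ≠ simpleRoot s := by
            intro h1
            have h2 : 0 ≤ geomRep cs (cs.simple s) (p • β + q • γ) := by
              rw [hmap]
              exact add_nonneg (smul_nonneg hp.le hβ1) (smul_nonneg hq.le hγ1)
            rw [h1, geomRep_simple_simpleRoot, neg_nonneg] at h2
            exact (isRoot_simpleRoot cs s).not_nonpos (simpleRoot_nonneg s) h2
          have hδ := geomRep_simple_mem_inversions hmem hδs
          rw [hmap] at hδ
          refine Or.inr (ih hc.rotate (hβ.map _) hβ1 (hγ.map _) hγ1 ?_ hδ h)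
          rwa [skewForm_rotate_geomRep cs hc]
      · have h0 : (p • β + q • γ) s = 0 := by
          by_contra h1
          exact hs _ hmem s h1 rfl
        simp only [Finsupp.add_apply, Finsupp.smul_apply, smul_eq_mul] at h0
        have hβs : 0 ≤ β s := hβ0 s
        have hγs : 0 ≤ γ s := hγ0 s
        have hβz : β s = 0 := by
          have := mul_nonneg hq.le hγs
          have := mul_nonneg hp.le hβs
          exact (mul_eq_zero.1 (show p * β s = 0 by linarith)).resolve_left hp.ne'
        have hγz : γ s = 0 := by
          rw [hβz, mul_zero, zero_add] at h0
          exact (mul_eq_zero.1 h0).resolve_left hq.ne'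
        refine ih hc.rotate hβ hβ0 hγ hγ0 ?_ hmem h
        rwa [skewForm_rotate_of_apply_eq_zero hc hβz hγz]

theorem mem_inversions_simple_mul_iff [Finite W] {cs : CoxeterSystem M W} {w : W} {s : B}
    (h : cs.IsLeftDescent w s) {γ : B →₀ ℝ} :
    γ ∈ inversions cs (cs.simple s * w) ↔
      geomRep cs (cs.simple s) γ ∈ inversions cs w ∧
        geomRep cs (cs.simple s) γ ≠ simpleRoot s := by
  constructor
  · intro hγ
    refine ⟨?_, ?_⟩
    · rw [mem_inversions_iff_of_isLeftDescent h, geomRep_simple_simple_apply]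
      exact Or.inr hγ
    · intro h1
      have h2 : γ = -simpleRoot s := by
        rw [← geomRep_simple_simple_apply cs s γ, h1, geomRep_simple_simpleRoot]
      have h3 := hγ.2.1
      rw [h2, neg_nonneg] at h3
      exact (isRoot_simpleRoot cs s).not_nonpos (simpleRoot_nonneg s) h3
  · rintro ⟨h1, h2⟩
    have := geomRep_simple_mem_inversions h1 h2
    rwa [geomRep_simple_simple_apply] at this

/-- An extremal inversion (for the skew form) of an element readable with commuting skips can
be removed. -/
theorem reads_reflection_mul [Finite W] {cs : CoxeterSystem M W} {c : List B}
    (hc : IsEnumeration c) {g : W} (h : Reads cs (fun s t => M s t = 2) c g) {β : B →₀ ℝ}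
    (hβ : β ∈ inversions cs g) {t : W} (ht : ∀ x, geomRep cs t x = x - (2 * form M β x) • β)
    (hle : ∀ γ ∈ inversions cs g, skewForm M c β γ ≤ 0) :
    Reads cs (fun s t => M s t = 2) c (t * g) ∧
      inversions cs (t * g) = inversions cs g \ {β} := by
  obtain ⟨n, h⟩ := h
  induction n generalizing c g β t with
  | zero =>
    obtain rfl : g = 1 := h
    rw [inversions_one] at hβ
    exact hβ.elim
  | succ n ih =>
    cases c with
    | nil =>
      obtain rfl : g = 1 := h
      rw [inversions_one] at hβ
      exact hβ.elim
    | cons s c =>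
      rcases h with ⟨hs, h⟩ | ⟨hs, h⟩
      · by_cases hβs : β = simpleRoot s
        · subst hβs
          have key : ∀ γ ∈ inversions cs g, γ ≠ simpleRoot s →
              (∀ r, γ r ≠ 0 → M s r = 2) ∧ geomRep cs (cs.simple s) γ = γ := by
            intro γ hγ hne
            have h1 : skewForm M (s :: c) (simpleRoot s) γ = 0 :=
              le_antisymm (hle γ hγ) (skewForm_cons_nonneg M s c hγ.2.1)
            have h2 := h1
            rw [skewForm_cons_simpleRoot, sub_eq_zero] at h2
            have h3 := hγ.1.geomRep_simple_nonneg hγ.2.1 hne s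
            have h4 := hγ.2.1 s
            rw [geomRep_simple_apply, ← h2] at h3
            simp only [Finsupp.coe_zero, Pi.zero_apply, Finsupp.sub_apply, Finsupp.smul_apply,
              simpleRoot_apply_self, smul_eq_mul, mul_one] at h3 h4
            have h5 : γ s = 0 := by linarith
            refine ⟨fun r hr => ?_, ?_⟩
            · refine coxeterMatrix_eq_two_of_skewForm_cons_eq_zero hγ.2.1 h1 ?_ hr
              rintro rfl
              exact hr h5
            · rw [geomRep_simple_apply, ← h2, h5]
              simp
          have hts : t = cs.simple s := by
            have : t * cs.simple s = 1 := by
              refine eq_one_of_geomRep_eq_one cs (LinearMap.ext fun x => ?_)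
              rw [geomRep_mul_apply, ht, ← geomRep_simple_apply cs s,
                geomRep_simple_simple_apply, Module.End.one_apply]
            rw [mul_eq_one_iff_eq_inv.1 this, cs.inv_simple]
          subst hts
          have hfix : ∀ γ ∈ inversions cs (cs.simple s * g), γ ∈ inversions cs g ∧
              γ ≠ simpleRoot s := by
            intro γ hγ
            rw [mem_inversions_simple_mul_iff hs] at hγ
            have h1 := (key _ hγ.1 hγ.2).2
            rw [geomRep_simple_simple_apply] at h1
            rwa [← h1] at hγ
          refine ⟨reads_cons_iff.2 (Or.inr ⟨?_, ⟨n, h⟩⟩), ?_⟩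
          · intro γ hγ r hr
            exact (key γ (hfix γ hγ).1 (hfix γ hγ).2).1 r hr
          · ext γ
            refine ⟨hfix γ, fun hγ => ?_⟩
            rw [mem_inversions_simple_mul_iff hs, (key γ hγ.1 hγ.2).2]
            exact hγ
        · have hβ1 := geomRep_simple_mem_inversions hβ hβs
          have ht1 : ∀ x, geomRep cs (cs.simple s * t * cs.simple s) x =
              x - (2 * form M (geomRep cs (cs.simple s) β) x) •
                geomRep cs (cs.simple s) β := by
            intro x
            rw [geomRep_mul_apply, geomRep_mul_apply, ht, map_sub, map_smul,
              geomRep_simple_simple_apply]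
            conv_rhs => rw [← geomRep_simple_simple_apply cs s x, form_geomRep,
              geomRep_simple_simple_apply cs s x]
          have hle1 : ∀ γ ∈ inversions cs (cs.simple s * g),
              skewForm M (c ++ [s]) (geomRep cs (cs.simple s) β) γ ≤ 0 := by
            intro γ hγ
            rw [← geomRep_simple_simple_apply cs s γ, skewForm_rotate_geomRep cs hc]
            exact hle _ ((mem_inversions_simple_mul_iff hs).1 hγ).1
          obtain ⟨hr, hinv⟩ := ih hc.rotate hβ1 ht1 hle1 h
          have hmul : cs.simple s * t * cs.simple s * (cs.simple s * g) =
              cs.simple s * (t * g) := by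
            rw [mul_assoc, cs.simple_mul_simple_cancel_left, mul_assoc]
          rw [hmul] at hr hinv
          have hd : cs.IsLeftDescent (t * g) s := by
            rw [cs.isLeftDescent_iff_not_isLeftDescent_mul, isLeftDescent_iff_simpleRoot_mem,
              hinv]
            exact fun h1 => simpleRoot_notMem_inversions_mul hs h1.1
          refine ⟨reads_cons_iff.2 (Or.inl ⟨hd, hr⟩), ?_⟩
          ext γ
          have hinj : geomRep cs (cs.simple s) γ = geomRep cs (cs.simple s) β ↔ γ = β := by
            refine ⟨fun h1 => ?_, fun h1 => h1 ▸ rfl⟩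
            rw [← geomRep_simple_simple_apply cs s γ, h1, geomRep_simple_simple_apply]
          rw [mem_inversions_iff_of_isLeftDescent hd, hinv, Set.mem_sdiff, Set.mem_sdiff,
            mem_inversions_iff_of_isLeftDescent hs, Set.mem_singleton_iff, Set.mem_singleton_iff,
            hinj]
          have : γ = simpleRoot s → γ ≠ β := by
            rintro rfl h1
            exact hβs h1.symm
          tauto
      · have hzero : ∀ γ ∈ inversions cs g, γ s = 0 := by
          intro γ hγ
          by_contra h1
          have h2 : M s s = 2 := hs γ hγ s h1
          simp at h2
        have hle1 : ∀ γ ∈ inversions cs g, skewForm M (c ++ [s]) β γ ≤ 0 := by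
          intro γ hγ
          rw [skewForm_rotate_of_apply_eq_zero hc (hzero β hβ) (hzero γ hγ)]
          exact hle γ hγ
        obtain ⟨hr, hinv⟩ := ih hc.rotate hβ ht hle1 h
        refine ⟨reads_cons_iff.2 (Or.inr ⟨?_, hr⟩), hinv⟩
        intro γ hγ
        rw [hinv] at hγ
        exact hs γ hγ.1

theorem Reads.simple_mul_of_append [Finite W] {cs : CoxeterSystem M W} {c : List B} {f : B}
    (hc : IsEnumeration (c ++ [f])) {g : W} (h : Reads cs (fun s t => M s t = 2) (c ++ [f]) g)
    (hf : cs.IsLeftDescent g f) :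
    Reads cs (fun s t => M s t = 2) (c ++ [f]) (cs.simple f * g) := by
  refine (reads_reflection_mul hc h ((isLeftDescent_iff_simpleRoot_mem cs g f).1 hf)
    (geomRep_simple_apply cs f) fun γ hγ => ?_).1
  rw [skewForm_append_simpleRoot hc.rotate_symm, neg_nonpos]
  exact skewForm_cons_nonneg M f c hγ.2.1

theorem exists_reads_rotate [Finite W] {cs : CoxeterSystem M W} {l l' : List B}
    (hc : IsEnumeration (l ++ l')) {g : W}
    (h : Reads cs (fun s t => M s t = 2) (l ++ l') g) :
    ∃ g', Reads cs (fun s t => M s t = 2) (l' ++ l) g' ∧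
      (cs.length g < cs.length g' ∨ g' = g ∧ ∀ f ∈ l', cs.IsLeftDescent g f) := by
  induction l' using List.reverseRecOn generalizing l g with
  | nil => exact ⟨g, by simpa using h, Or.inr ⟨rfl, by simp⟩⟩
  | append_singleton l' f ih =>
    rw [← List.append_assoc] at hc h
    have hc1 : IsEnumeration ((f :: l) ++ l') := hc.rotate_symm
    by_cases hf : cs.IsLeftDescent g f
    · have h1 : Reads cs (fun s t => M s t = 2) ((f :: l) ++ l') g :=
        reads_cons_iff.2 (Or.inl ⟨hf, h.simple_mul_of_append hc hf⟩)
      obtain ⟨g', hg', hor⟩ := ih hc1 h1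
      refine ⟨g', by simpa using hg', hor.imp_right (And.imp_right fun hl x hx => ?_)⟩
      rw [List.mem_append, List.mem_singleton] at hx
      rcases hx with hx | rfl
      · exact hl x hx
      · exact hf
    · have hlen := cs.not_isLeftDescent_iff.1 hf
      have h1 : Reads cs (fun s t => M s t = 2) ((f :: l) ++ l') (cs.simple f * g) := by
        refine reads_cons_iff.2 (Or.inl ⟨(isLeftDescent_mul_iff_not cs g f).2 hf, ?_⟩)
        rwa [cs.simple_mul_simple_cancel_left]
      obtain ⟨g', hg', hor⟩ := ih hc1 h1
      refine ⟨g', by simpa using hg', Or.inl ?_⟩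
      rcases hor with hlt | ⟨rfl, -⟩ <;> omega

/-- The longest element can be read along `c^∞` with commuting skips only. -/
theorem reads_longest [Finite W] {cs : CoxeterSystem M W} {c : List B} (hc : IsEnumeration c)
    {w₀ : W} (hw₀ : ∀ u : W, cs.length u ≤ cs.length w₀) :
    Reads cs (fun s t => M s t = 2) c w₀ := by
  obtain ⟨g, hg, hmax⟩ := Set.exists_max_image {g | Reads cs (fun s t => M s t = 2) c g}
    cs.length (Set.toFinite _) ⟨1, reads_one cs _ c⟩
  obtain ⟨g', hg', hor⟩ := exists_reads_rotate (l := []) hc hg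
  rw [List.append_nil] at hg'
  have hle := hmax g' hg'
  have hall := (hor.resolve_left (by omega)).2
  rw [← eq_of_forall_isLeftDescent hw₀ fun s => hall s (hc.2 s)]
  exact hg

/-! ### Singletons as readable elements -/

theorem isSortable_cons_iff_of_isLeftDescent [Finite W] {cs : CoxeterSystem M W} {s : B}
    {c : List B} (hc : IsEnumeration (s :: c)) {w : W} (hs : cs.IsLeftDescent w s) :
    IsSortable cs (s :: c) w ↔ IsSortable cs (c ++ [s]) (cs.simple s * w) := by
  have hnot : ¬InParabolic cs {t | t ≠ s} w := fun h => h.mem_of_isLeftDescent hs rfl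
  rw [isSortable_cons_iff cs hc]
  tauto

theorem isCSingleton_cons_iff_of_isLeftDescent [Finite W] {cs : CoxeterSystem M W} {s : B}
    {c : List B} (hc : IsEnumeration (s :: c)) {w₀ w : W}
    (hw₀ : ∀ u : W, cs.length u ≤ cs.length w₀) (hs : cs.IsLeftDescent w s) :
    IsCSingleton cs (s :: c) w₀ w ↔ IsCSingleton cs (c ++ [s]) w₀ (cs.simple s * w) := by
  have hc' : IsEnumeration (s :: c.reverse) := by simpa using hc.rotate.reverse
  have hs' : cs.IsLeftDescent (cs.simple s * w * w₀) s := by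
    rw [mul_assoc, isLeftDescent_mul_iff_not, isLeftDescent_mul_longest_iff hw₀, not_not]
    exact hs
  have h := isSortable_cons_iff_of_isLeftDescent hc' hs'
  rw [mul_assoc, cs.simple_mul_simple_cancel_left] at h
  rw [IsCSingleton, IsCSingleton, isSortable_cons_iff_of_isLeftDescent hc hs, List.reverse_cons,
    List.reverse_append, List.reverse_singleton, List.singleton_append, mul_assoc, h]

theorem isCSingleton_commute_iff [Finite W] {cs : CoxeterSystem M W} {r : B} {a b : List B}
    (hc : IsEnumeration (a ++ r :: b)) (ha : ∀ s ∈ a, M s r = 2) {w₀ w : W} :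
    IsCSingleton cs (r :: (a ++ b)) w₀ w ↔ IsCSingleton cs (a ++ r :: b) w₀ w := by
  have h := iff_of_forall_commMove
    (Q := fun l => IsEnumeration l ∧ IsCSingleton cs l w₀ w) (fun l l' hm hl =>
      ⟨hl.1.perm hm.perm, hl.2.1.of_commMove hl.1 hm,
        hl.2.2.of_commMove hl.1.reverse hm.reverse⟩) [] a b ha
  have hc' : IsEnumeration (r :: (a ++ b)) := hc.perm List.perm_middle
  simpa [hc, hc'] using h

theorem exists_first_letter {cs : CoxeterSystem M W} [Finite W] {c : List B} {w : W}
    (h : Reads cs (fun s t => M s t = 2) c w) (hw : w ≠ 1) :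
    ∃ a r b, c = a ++ r :: b ∧ (∀ s ∈ a, M s r = 2) ∧ cs.IsLeftDescent w r ∧
      Reads cs (fun s t => M s t = 2) (a ++ b ++ [r]) (cs.simple r * w) := by
  obtain ⟨n, h⟩ := h
  induction n generalizing c with
  | zero => exact absurd h hw
  | succ n ih =>
    cases c with
    | nil => exact absurd h hw
    | cons s c =>
      rcases h with ⟨hs, h⟩ | ⟨hs, h⟩
      · exact ⟨[], s, c, rfl, by simp, hs, n, h⟩
      · obtain ⟨a, r, b, hab, ha, hr, hread⟩ := ih h
        have hsr : M s r = 2 := hs.mem_of_isLeftDescent hr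
        rcases List.eq_nil_or_concat' b with rfl | ⟨b, x, rfl⟩
        · have := (List.append_inj' hab rfl).2
          simp only [List.cons.injEq, and_true] at this
          exact absurd this (ne_of_coxeterMatrix_eq_two hsr)
        · rw [← List.cons_append, ← List.append_assoc] at hab
          obtain ⟨rfl, hx⟩ := List.append_inj' hab rfl
          obtain rfl : s = x := by simpa using hx
          refine ⟨s :: a, r, b, rfl, ?_, hr, ?_⟩
          · intro y hy
            rcases List.mem_cons.1 hy with rfl | hy
            · exact hsr
            · exact ha y hy
          · have hmove : CommMove M (a ++ (b ++ [s]) ++ [r]) (a ++ b ++ [r] ++ [s]) :=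
              ⟨a ++ b, [], s, r, hsr, by simp, by simp⟩
            exact reads_cons_iff.2 (Or.inr ⟨hs.of_isLeftDescent hr,
              hread.of_commMove (fun _ _ => id) hmove⟩)

theorem Reads.isCSingleton [Finite W] {cs : CoxeterSystem M W} {c : List B}
    (hc : IsEnumeration c) {w₀ w : W} (hw₀ : ∀ u : W, cs.length u ≤ cs.length w₀)
    (h : Reads cs (fun s t => M s t = 2) c w) : IsCSingleton cs c w₀ w := by
  induction hn : cs.length w using Nat.strong_induction_on generalizing c w with
  | _ n ih =>
  by_cases hw : w = 1
  · subst hw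
    refine ⟨isSortable_one cs c, ?_⟩
    rw [one_mul, isSortable_iff_reads hc.reverse]
    exact (reads_longest hc.reverse hw₀).mono
      fun s t hst => (ne_of_coxeterMatrix_eq_two hst).symm
  · obtain ⟨a, r, b, rfl, ha, hr, hread⟩ := exists_first_letter h hw
    have hlen := length_simple_mul_of_isLeftDescent hr
    have hc' : IsEnumeration (r :: (a ++ b)) := hc.perm List.perm_middle
    rw [← isCSingleton_commute_iff hc ha, isCSingleton_cons_iff_of_isLeftDescent hc' hw₀ hr]
    exact ih _ (by omega) hc'.rotate hread rfl

theorem exists_eq_append_first {α : Type*} {p : α → Prop} (c : List α) (h : ∃ x ∈ c, p x) :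
    ∃ a r b, c = a ++ r :: b ∧ p r ∧ ∀ s ∈ a, ¬p s := by
  induction c with
  | nil => simp at h
  | cons x c ih =>
    by_cases hx : p x
    · exact ⟨[], x, c, rfl, hx, by simp⟩
    · obtain ⟨y, hy, hpy⟩ := h
      have hyc : y ∈ c := (List.mem_cons.1 hy).resolve_left (by rintro rfl; exact hx hpy)
      obtain ⟨a, r, b, rfl, hr, ha⟩ := ih ⟨y, hyc, hpy⟩
      refine ⟨x :: a, r, b, rfl, hr, fun s hs => ?_⟩
      rcases List.mem_cons.1 hs with rfl | hs
      · exact hx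
      · exact ha s hs

theorem IsSortable.inParabolic_of_not_isLeftDescent [Finite W] {cs : CoxeterSystem M W}
    {a b : List B} (hc : IsEnumeration (a ++ b)) {w : W} (h : IsSortable cs (a ++ b) w)
    (ha : ∀ s ∈ a, ¬cs.IsLeftDescent w s) {s : B} (hs : s ∈ a) :
    InParabolic cs {t | t ≠ s} w := by
  induction a generalizing b with
  | nil => simp at hs
  | cons x a ih =>
    have h1 := ((isSortable_cons_iff cs hc w).1 h).resolve_left fun h1 => ha x (by simp) h1.1
    rcases List.mem_cons.1 hs with rfl | hs
    · exact h1.1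
    · exact ih (b := b ++ [x]) (by simpa using hc.rotate) (by simpa using h1.2)
        (fun y hy => ha y (by simp [hy])) hs

theorem skewCoeff_reverse (M : CoxeterMatrix B) {a b : List B} {r s : B}
    (hc : (a ++ r :: b).Nodup) (hs : s ∈ a) :
    skewCoeff M (a ++ r :: b).reverse r s = -gram M r s := by
  classical
  have heq : (a ++ r :: b).reverse = (b.reverse ++ [r]) ++ a.reverse := by simp
  have hr : r ∈ b.reverse ++ [r] := by simp
  have hsn : s ∉ b.reverse ++ [r] := by
    intro h
    refine (List.nodup_append.1 hc).2.2 s hs s ?_ rfl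
    simpa [or_comm] using h
  have h1 := List.idxOf_lt_length_of_mem hr
  rw [skewCoeff, heq, List.idxOf_append_of_mem hr, List.idxOf_append_of_notMem hsn,
    if_pos (by omega)]

theorem IsCSingleton.commute_of_first [Finite W] {cs : CoxeterSystem M W} {a b : List B} {r : B}
    (hc : IsEnumeration (a ++ r :: b)) {w₀ w : W} (hw₀ : ∀ u : W, cs.length u ≤ cs.length w₀)
    (h : IsCSingleton cs (a ++ r :: b) w₀ w) (hr : cs.IsLeftDescent w r)
    (ha : ∀ s ∈ a, ¬cs.IsLeftDescent w s) {s : B} (hs : s ∈ a) : M s r = 2 := by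
  by_contra hM
  have hsr : s ≠ r := by
    rintro rfl
    exact ha s hs hr
  have hg : gram M s r < 0 :=
    lt_of_le_of_ne (gram_nonpos M hsr) fun h0 => hM (eq_two_of_gram_eq_zero M hsr h0)
  have hδ : geomRep cs (cs.simple s) (simpleRoot r) =
      (1 : ℝ) • simpleRoot r + (-(2 * gram M s r)) • simpleRoot s := by
    rw [geomRep_simple_apply, bilin_simpleRoot]
    module
  have hδr := (isRoot_simpleRoot cs r).map (cs.simple s)
  have hδ0 := (isRoot_simpleRoot cs r).geomRep_simple_nonneg (simpleRoot_nonneg r) (s := s) (by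
    intro h1
    have h2 := congrArg (fun v => v s) h1
    simp only [simpleRoot_apply_self, simpleRoot_apply_of_ne hsr.symm] at h2
    exact zero_ne_one h2)
  have hnot : geomRep cs (cs.simple s) (simpleRoot r) ∉ inversions cs w := by
    intro h1
    refine h.1.inParabolic_of_not_isLeftDescent hc ha hs _ h1 s ?_ rfl
    rw [hδ]
    simp [simpleRoot_apply_self, simpleRoot_apply_of_ne hsr.symm, hg.ne]
  rw [← mem_inversions_mul_longest_iff hw₀ w hδr hδ0, hδ] at hnot
  have hmem := mem_inversions_of_skewForm_pos hc.reverse (h.2.reads hc.reverse)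
    (isRoot_simpleRoot cs r) (simpleRoot_nonneg r) (isRoot_simpleRoot cs s)
    (simpleRoot_nonneg s) one_pos (by linarith) (by
      rw [bilin_simpleRoot, skewCoeff_reverse M hc.1 hs, gram_comm]
      linarith) hnot
  rw [← isLeftDescent_iff_simpleRoot_mem, isLeftDescent_mul_longest_iff hw₀] at hmem
  exact hmem hr

theorem IsCSingleton.reads [Finite W] {cs : CoxeterSystem M W} {c : List B}
    (hc : IsEnumeration c) {w₀ w : W} (hw₀ : ∀ u : W, cs.length u ≤ cs.length w₀)
    (h : IsCSingleton cs c w₀ w) : Reads cs (fun s t => M s t = 2) c w := by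
  induction hn : cs.length w using Nat.strong_induction_on generalizing c w with
  | _ n ih =>
  by_cases hw : w = 1
  · subst hw
    exact reads_one cs _ c
  · obtain ⟨x, hx⟩ := cs.exists_leftDescent_of_ne_one hw
    obtain ⟨a, r, b, rfl, hr, ha⟩ := exists_eq_append_first c ⟨x, hc.2 x, hx⟩
    have hlen := length_simple_mul_of_isLeftDescent hr
    have hcomm : ∀ s ∈ a, M s r = 2 := fun s hs => h.commute_of_first hc hw₀ hr ha hs
    have hc' : IsEnumeration (r :: (a ++ b)) := hc.perm List.perm_middle
    rw [← isCSingleton_commute_iff hc hcomm, isCSingleton_cons_iff_of_isLeftDescent hc' hw₀ hr]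
      at h
    have hread := reads_cons_iff.2 (Or.inl ⟨hr, ih _ (by omega) hc'.rotate h rfl⟩)
    exact (iff_of_forall_commMove (Q := fun l => Reads cs (fun s t => M s t = 2) l w)
      (fun l l' hm hl => hl.of_commMove (fun _ _ => id) hm) [] a b hcomm).1 hread

/-! ### Meets and joins -/

theorem geomRep_simple_apply_of_inParabolic {cs : CoxeterSystem M W} {s : B} {v : W}
    (h : InParabolic cs {t | M s t = 2} v) {γ : B →₀ ℝ} (hγ : γ ∈ inversions cs v) :
    geomRep cs (cs.simple s) γ = γ := by
  have h0 : form M (simpleRoot s) γ = 0 := by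
    rw [bilin_simpleRoot_left]
    refine Finset.sum_eq_zero fun t ht => ?_
    change γ t * gram M s t = 0
    rw [gram_eq_zero M (h γ hγ t (Finsupp.mem_support_iff.1 ht)), mul_zero]
  rw [geomRep_simple_apply, h0]
  simp

theorem simpleRoot_notMem_of_inParabolic [Finite W] {cs : CoxeterSystem M W} {s : B} {v : W}
    (h : InParabolic cs {t | M s t = 2} v) : simpleRoot s ∉ inversions cs v := by
  rw [← isLeftDescent_iff_simpleRoot_mem]
  intro hs
  have h1 : M s s = 2 := h.mem_of_isLeftDescent hs
  simp at h1

theorem isLeftDescent_simple_mul_of_notMem [Finite W] {cs : CoxeterSystem M W} {s : B} {j : W}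
    (h : simpleRoot s ∉ inversions cs j) : cs.IsLeftDescent (cs.simple s * j) s := by
  rwa [isLeftDescent_mul_iff_not, isLeftDescent_iff_simpleRoot_mem]

theorem mem_inversions_simple_mul_of_notMem [Finite W] {cs : CoxeterSystem M W} {s : B} {j : W}
    (h : simpleRoot s ∉ inversions cs j) {γ : B →₀ ℝ} :
    γ ∈ inversions cs (cs.simple s * j) ↔
      γ = simpleRoot s ∨ geomRep cs (cs.simple s) γ ∈ inversions cs j := by
  rw [mem_inversions_iff_of_isLeftDescent (isLeftDescent_simple_mul_of_notMem h),
    cs.simple_mul_simple_cancel_left]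

theorem geomRep_simple_mem_iff_of_inParabolic {cs : CoxeterSystem M W} {s : B} {v : W}
    (h : InParabolic cs {t | M s t = 2} v) {γ : B →₀ ℝ} :
    geomRep cs (cs.simple s) γ ∈ inversions cs v ↔ γ ∈ inversions cs v := by
  constructor
  · intro hγ
    have := geomRep_simple_apply_of_inParabolic h hγ
    rw [geomRep_simple_simple_apply] at this
    rwa [← this] at hγ
  · intro hγ
    rwa [geomRep_simple_apply_of_inParabolic h hγ]

/-- Reading a common letter `s` of `u` which is skipped by `v`. -/
theorem reads_join_meet_of_skip [Finite W] {cs : CoxeterSystem M W} {s : B} {c : List B}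
    {u v j m : W} (hu : cs.IsLeftDescent u s) (hv : InParabolic cs {t | M s t = 2} v)
    (hj : Reads cs (fun s t => M s t = 2) (c ++ [s]) j)
    (hm : Reads cs (fun s t => M s t = 2) (c ++ [s]) m)
    (hjinv : inversions cs j = inversions cs (cs.simple s * u) ∪ inversions cs v)
    (hminv : inversions cs m = inversions cs (cs.simple s * u) ∩ inversions cs v) :
    (∃ j, Reads cs (fun s t => M s t = 2) (s :: c) j ∧
        inversions cs j = inversions cs u ∪ inversions cs v) ∧
      ∃ m, Reads cs (fun s t => M s t = 2) (s :: c) m ∧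
        inversions cs m = inversions cs u ∩ inversions cs v := by
  have hsj : simpleRoot s ∉ inversions cs j := by
    rw [hjinv]
    exact fun h => h.elim (simpleRoot_notMem_inversions_mul hu)
      (simpleRoot_notMem_of_inParabolic hv)
  refine ⟨⟨cs.simple s * j, reads_cons_iff.2 (Or.inl
    ⟨isLeftDescent_simple_mul_of_notMem hsj, ?_⟩), ?_⟩, m, reads_cons_iff.2 (Or.inr ⟨?_, hm⟩), ?_⟩
  · rwa [cs.simple_mul_simple_cancel_left]
  · ext γ
    rw [mem_inversions_simple_mul_of_notMem hsj, hjinv, Set.mem_union, Set.mem_union,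
      mem_inversions_iff_of_isLeftDescent hu, geomRep_simple_mem_iff_of_inParabolic hv, or_assoc]
  · intro γ hγ
    rw [hminv] at hγ
    exact hv γ hγ.2
  · ext γ
    rw [hminv, Set.mem_inter_iff, Set.mem_inter_iff, and_congr_left_iff]
    intro hγ
    rw [mem_inversions_simple_mul_iff hu, geomRep_simple_apply_of_inParabolic hv hγ]
    refine and_iff_left ?_
    rintro rfl
    exact simpleRoot_notMem_of_inParabolic hv hγ

theorem Reads.exists_join_meet [Finite W] {cs : CoxeterSystem M W} {c : List B} {u v : W}
    (hu : Reads cs (fun s t => M s t = 2) c u) (hv : Reads cs (fun s t => M s t = 2) c v) :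
    (∃ j, Reads cs (fun s t => M s t = 2) c j ∧
        inversions cs j = inversions cs u ∪ inversions cs v) ∧
      ∃ m, Reads cs (fun s t => M s t = 2) c m ∧
        inversions cs m = inversions cs u ∩ inversions cs v := by
  obtain ⟨n, hu⟩ := hu
  induction n generalizing c u v with
  | zero =>
    obtain rfl : u = 1 := hu
    exact ⟨⟨v, hv, by simp [inversions_one]⟩, 1, reads_one cs _ c, by simp [inversions_one]⟩
  | succ n ih =>
    cases c with
    | nil =>
      obtain rfl : u = 1 := hu
      exact ⟨⟨v, hv, by simp [inversions_one]⟩, 1, reads_one cs _ _, by simp [inversions_one]⟩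
    | cons s c =>
      rcases hu with ⟨hus, hu⟩ | ⟨hus, hu⟩ <;> rcases reads_cons_iff.1 hv with ⟨hvs, hv⟩ | ⟨hvs, hv⟩
      all_goals obtain ⟨⟨j, hj, hjinv⟩, m, hm, hminv⟩ := ih hv hu
      · have hsj : simpleRoot s ∉ inversions cs j := by
          rw [hjinv]
          exact fun h => h.elim (simpleRoot_notMem_inversions_mul hus)
            (simpleRoot_notMem_inversions_mul hvs)
        have hsm : simpleRoot s ∉ inversions cs m := by
          rw [hminv]
          exact fun h => simpleRoot_notMem_inversions_mul hus h.1
        refine ⟨⟨cs.simple s * j, reads_cons_iff.2 (Or.inl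
            ⟨isLeftDescent_simple_mul_of_notMem hsj, ?_⟩), ?_⟩,
          cs.simple s * m, reads_cons_iff.2 (Or.inl
            ⟨isLeftDescent_simple_mul_of_notMem hsm, ?_⟩), ?_⟩
        · rwa [cs.simple_mul_simple_cancel_left]
        · ext γ
          rw [mem_inversions_simple_mul_of_notMem hsj, hjinv, Set.mem_union, Set.mem_union,
            mem_inversions_iff_of_isLeftDescent hus, mem_inversions_iff_of_isLeftDescent hvs]
          tauto
        · rwa [cs.simple_mul_simple_cancel_left]
        · ext γ
          rw [mem_inversions_simple_mul_of_notMem hsm, hminv, Set.mem_inter_iff,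
            Set.mem_inter_iff, mem_inversions_iff_of_isLeftDescent hus,
            mem_inversions_iff_of_isLeftDescent hvs]
          tauto
      · exact reads_join_meet_of_skip hus hvs hj hm hjinv hminv
      · rw [Set.union_comm] at hjinv ⊢
        rw [Set.inter_comm] at hminv ⊢
        exact reads_join_meet_of_skip hvs hus hj hm hjinv hminv
      · refine ⟨⟨j, reads_cons_iff.2 (Or.inr ⟨?_, hj⟩), hjinv⟩,
          m, reads_cons_iff.2 (Or.inr ⟨?_, hm⟩), hminv⟩
        · intro γ hγ
          rw [hjinv] at hγ
          exact hγ.elim (hus γ) (hvs γ)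
        · intro γ hγ
          rw [hminv] at hγ
          exact hus γ hγ.1

/-- The `c`-singletons form a distributive sublattice of the right weak order
on `W`: any two `c`-singletons have a meet and a join *in the weak order on all of `W`*, these
are again `c`-singletons, and the resulting lattice operations are distributive. -/
theorem statement4 [Finite W] (cs : CoxeterSystem M W)
    (c : List B) (hnd : c.Nodup) (hall : ∀ b : B, b ∈ c)
    (w₀ : W) (hw₀ : ∀ u : W, cs.length u ≤ cs.length w₀) :
    ∃ meet join : {w : W // IsCSingleton cs c w₀ w} → {w : W // IsCSingleton cs c w₀ w} →
        {w : W // IsCSingleton cs c w₀ w},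
      (∀ a b : {w : W // IsCSingleton cs c w₀ w},
        weakLE cs (meet a b).1 a.1 ∧ weakLE cs (meet a b).1 b.1 ∧
          ∀ z : W, weakLE cs z a.1 → weakLE cs z b.1 → weakLE cs z (meet a b).1) ∧
      (∀ a b : {w : W // IsCSingleton cs c w₀ w},
        weakLE cs a.1 (join a b).1 ∧ weakLE cs b.1 (join a b).1 ∧
          ∀ z : W, weakLE cs a.1 z → weakLE cs b.1 z → weakLE cs (join a b).1 z) ∧
      (∀ a b d : {w : W // IsCSingleton cs c w₀ w},
        meet a (join b d) = join (meet a b) (meet a d)) := by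
  have hc : IsEnumeration c := ⟨hnd, hall⟩
  have hex : ∀ a b : {w : W // IsCSingleton cs c w₀ w},
      (∃ j : {w : W // IsCSingleton cs c w₀ w},
        inversions cs j.1 = inversions cs a.1 ∪ inversions cs b.1) ∧
      ∃ m : {w : W // IsCSingleton cs c w₀ w},
        inversions cs m.1 = inversions cs a.1 ∩ inversions cs b.1 := by
    intro a b
    obtain ⟨⟨j, hj, hjinv⟩, m, hm, hminv⟩ :=
      (a.2.reads hc hw₀).exists_join_meet (b.2.reads hc hw₀)
    exact ⟨⟨⟨j, hj.isCSingleton hc hw₀⟩, hjinv⟩, ⟨m, hm.isCSingleton hc hw₀⟩, hminv⟩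
  choose join hjoin using fun a b => (hex a b).1
  choose meet hmeet using fun a b => (hex a b).2
  refine ⟨meet, join, fun a b => ?_, fun a b => ?_, fun a b d => ?_⟩
  · simp only [weakLE_iff_inversions_subset, hmeet]
    exact ⟨Set.inter_subset_left, Set.inter_subset_right, fun z h1 h2 => Set.subset_inter h1 h2⟩
  · simp only [weakLE_iff_inversions_subset, hjoin]
    exact ⟨Set.subset_union_left, Set.subset_union_right, fun z h1 h2 => Set.union_subset h1 h2⟩
  · refine Subtype.ext (inversions_injective cs ?_)
    rw [hmeet, hjoin, hjoin, hmeet, hmeet, Set.inter_union_distrib_left]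

end CambrianPaper

end
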